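/- arXiv:2505.22607 — 5 statements merged into one kernel-verified Lean document; each statement's English description precedes it below -/
import Mathlib

section
/- Let N ≥ 1, let m be a natural number, let P : ℝ^N → ℂ be a polynomial function that is homogeneous of degree m and harmonic (ΔP = 0 on all of ℝ^N), and let f : ℝ → ℂ be smooth on (0,∞). Define F : ℝ^N \ {0} → ℂ by F(x) = P(x/‖x‖)·f(‖x‖). Then for every x ≠ 0, ‖x‖²·(ΔF)(x) = P(x/‖x‖)·( ‖x‖²·f″(‖x‖) + (N−1)·‖x‖·f′(‖x‖) − m(m+N−2)·f(‖x‖) ); equivalently, ‖x‖²Δ(p⊗f) = p ⊗ (ϑ−m)(ϑ+m+N−2)f. -/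
open MeasureTheory

/-- The Laplacian of a function on Euclidean space: the sum of second partial
derivatives along the standard orthonormal basis. -/
noncomputable def laplacian {N : ℕ} (G : EuclideanSpace ℝ (Fin N) → ℂ)
    (x : EuclideanSpace ℝ (Fin N)) : ℂ :=
  ∑ j : Fin N,
    fderiv ℝ (fun y => fderiv ℝ G y (EuclideanSpace.single j 1)) x
      (EuclideanSpace.single j 1)

theorem hasFDerivAt_comp_norm {N : ℕ} {k : ℝ → ℂ} {k' : ℂ} {y : EuclideanSpace ℝ (Fin N)}
    (hy : y ≠ 0) (hk : HasDerivAt k k' ‖y‖) :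
    HasFDerivAt (fun z : EuclideanSpace ℝ (Fin N) => k ‖z‖)
      ((‖y‖⁻¹ • innerSL ℝ y).smulRight k') y := by
  have h0 : ‖y‖ ^ 2 ≠ 0 := pow_ne_zero 2 (norm_ne_zero_iff.2 hy)
  have h1 := (hasStrictFDerivAt_norm_sq y).hasFDerivAt.sqrt h0
  have h2 : HasFDerivAt (fun z : EuclideanSpace ℝ (Fin N) => ‖z‖) (‖y‖⁻¹ • innerSL ℝ y) y := by
    simp only [Real.sqrt_sq (norm_nonneg _)] at h1
    refine h1.congr_fderiv ?_
    rw [two_smul ℕ, ← two_smul ℝ, smul_smul]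
    congr 1
    field_simp
  refine (hk.hasFDerivAt.comp y h2).congr_fderiv ?_
  ext z
  simp [mul_assoc]

theorem fderiv_comp_norm_single {N : ℕ} {k : ℝ → ℂ} {k' : ℂ} {y : EuclideanSpace ℝ (Fin N)}
    (hy : y ≠ 0) (hk : HasDerivAt k k' ‖y‖) (j : Fin N) :
    fderiv ℝ (fun z : EuclideanSpace ℝ (Fin N) => k ‖z‖) y (EuclideanSpace.single j 1)
      = (‖y‖ : ℂ)⁻¹ * (y j : ℂ) * k' := by
  rw [(hasFDerivAt_comp_norm hy hk).fderiv]
  simp [EuclideanSpace.inner_single_right]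

theorem fderiv_mul_comp_norm_single {N : ℕ} {Q : EuclideanSpace ℝ (Fin N) → ℂ}
    {k : ℝ → ℂ} {k' : ℂ} {y : EuclideanSpace ℝ (Fin N)} (hQ : DifferentiableAt ℝ Q y)
    (hy : y ≠ 0) (hk : HasDerivAt k k' ‖y‖) (j : Fin N) :
    fderiv ℝ (fun z => Q z * k ‖z‖) y (EuclideanSpace.single j 1)
      = fderiv ℝ Q y (EuclideanSpace.single j 1) * k ‖y‖
        + Q y * ((‖y‖ : ℂ)⁻¹ * (y j : ℂ) * k') := by
  rw [← fderiv_comp_norm_single hy hk j,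
    fderiv_fun_mul hQ (hasFDerivAt_comp_norm hy hk).differentiableAt]
  simp
  ring

theorem fderiv_mul_coord_single {N : ℕ} {Q : EuclideanSpace ℝ (Fin N) → ℂ}
    {y : EuclideanSpace ℝ (Fin N)} (hQ : DifferentiableAt ℝ Q y) (j : Fin N) :
    DifferentiableAt ℝ (fun z : EuclideanSpace ℝ (Fin N) => Q z * (z j : ℂ)) y ∧
    fderiv ℝ (fun z : EuclideanSpace ℝ (Fin N) => Q z * (z j : ℂ)) y (EuclideanSpace.single j 1)
      = fderiv ℝ Q y (EuclideanSpace.single j 1) * (y j : ℂ) + Q y := by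
  have h : HasFDerivAt (fun z : EuclideanSpace ℝ (Fin N) => (z j : ℂ))
      (Complex.ofRealCLM.comp (EuclideanSpace.proj j : EuclideanSpace ℝ (Fin N) →L[ℝ] ℝ)) y :=
    (Complex.ofRealCLM.comp
      (EuclideanSpace.proj j : EuclideanSpace ℝ (Fin N) →L[ℝ] ℝ)).hasFDerivAt
  refine ⟨hQ.mul h.differentiableAt, ?_⟩
  rw [fderiv_fun_mul hQ h.differentiableAt, h.fderiv]
  simp
  ring

theorem sum_coord_mul_fderiv {N : ℕ} (L : EuclideanSpace ℝ (Fin N) →L[ℝ] ℂ)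
    (x : EuclideanSpace ℝ (Fin N)) :
    ∑ j, (x j : ℂ) * L (EuclideanSpace.single j 1) = L x := by
  have hx : x = ∑ j, x j • EuclideanSpace.single j (1 : ℝ) := by
    ext i
    simp [Finset.sum_apply, Pi.single_apply]
  conv_rhs => rw [hx]
  simp [map_sum]

/-- **Euler's identity** for positively homogeneous functions. -/
theorem fderiv_self_of_homogeneous {N m : ℕ} {P : EuclideanSpace ℝ (Fin N) → ℂ}
    (hP : Differentiable ℝ P)
    (hPhom : ∀ (c : ℝ) (x : EuclideanSpace ℝ (Fin N)), 0 < c →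
      P (c • x) = (c : ℂ) ^ m * P x) (x : EuclideanSpace ℝ (Fin N)) :
    fderiv ℝ P x x = m * P x := by
  have h1 : HasDerivAt (fun c : ℝ => P (c • x)) (fderiv ℝ P x x) 1 := by
    have hs : HasDerivAt (fun c : ℝ => c • x) x 1 := by
      simpa using (hasDerivAt_id (1 : ℝ)).smul_const x
    have := (hP ((1 : ℝ) • x)).hasFDerivAt.comp_hasDerivAt (1 : ℝ) hs
    simpa [Function.comp_def] using this
  have h2 : HasDerivAt (fun c : ℝ => (c : ℂ) ^ m * P x) (m * P x) 1 := by
    have := (hasDerivAt_pow m ((1 : ℝ) : ℂ)).comp_ofReal.mul_const (P x)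
    simpa using this
  refine h1.unique (h2.congr_of_eventuallyEq ?_)
  filter_upwards [lt_mem_nhds (zero_lt_one (α := ℝ))] with c hc
  exact hPhom c x hc

theorem laplacian_congr_nhds {N : ℕ} {G H : EuclideanSpace ℝ (Fin N) → ℂ}
    {x : EuclideanSpace ℝ (Fin N)} (h : G =ᶠ[nhds x] H) : laplacian G x = laplacian H x := by
  refine Finset.sum_congr rfl fun j _ => ?_
  have : (fun y => fderiv ℝ G y (EuclideanSpace.single j 1)) =ᶠ[nhds x]
      fun y => fderiv ℝ H y (EuclideanSpace.single j 1) := by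
    filter_upwards [h.fderiv (𝕜 := ℝ)] with y hy
    rw [hy]
  rw [this.fderiv_eq]

/-- The Laplacian of a homogeneous function times a radial function. -/
theorem laplacian_mul_radial {N m : ℕ} {P : EuclideanSpace ℝ (Fin N) → ℂ}
    (hP : ContDiff ℝ 2 P)
    (hPhom : ∀ (c : ℝ) (x : EuclideanSpace ℝ (Fin N)), 0 < c →
      P (c • x) = (c : ℂ) ^ m * P x)
    {k k₁ k₂ : ℝ → ℂ} (hk : ∀ r, 0 < r → HasDerivAt k (k₁ r) r)
    (hk₁ : ∀ r, 0 < r → HasDerivAt k₁ (k₂ r) r)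
    {x : EuclideanSpace ℝ (Fin N)} (hx : x ≠ 0) :
    (‖x‖ : ℂ) ^ 2 * laplacian (fun y => P y * k ‖y‖) x =
      (‖x‖ : ℂ) ^ 2 * laplacian P x * k ‖x‖ +
      P x * ((‖x‖ : ℂ) ^ 2 * k₂ ‖x‖ + ((N : ℂ) - 1 + 2 * m) * (‖x‖ : ℂ) * k₁ ‖x‖) := by
  have hPd : Differentiable ℝ P := hP.differentiable (by norm_num)
  have hr : (0 : ℝ) < ‖x‖ := norm_pos_iff.2 hx
  have hrc : (‖x‖ : ℂ) ≠ 0 := by exact_mod_cast hr.ne'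
  have hq : ∀ r : ℝ, 0 < r →
      HasDerivAt (fun s : ℝ => (s : ℂ)⁻¹ * k₁ s) (-((r : ℂ) ^ 2)⁻¹ * k₁ r + (r : ℂ)⁻¹ * k₂ r) r := by
    intro r hr
    exact ((hasDerivAt_inv (Complex.ofReal_ne_zero.2 hr.ne')).comp_ofReal).mul (hk₁ r hr)
  have key : ∀ j : Fin N,
      fderiv ℝ (fun y => fderiv ℝ (fun y => P y * k ‖y‖) y (EuclideanSpace.single j 1)) x
        (EuclideanSpace.single j 1) =
      fderiv ℝ (fun y => fderiv ℝ P y (EuclideanSpace.single j 1)) x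
        (EuclideanSpace.single j 1) * k ‖x‖
      + 2 * (‖x‖ : ℂ)⁻¹ * k₁ ‖x‖ * ((x j : ℂ) * fderiv ℝ P x (EuclideanSpace.single j 1))
      + P x * ((‖x‖ : ℂ)⁻¹ * k₁ ‖x‖)
      + P x * (‖x‖ : ℂ)⁻¹ * (-((‖x‖ : ℂ) ^ 2)⁻¹ * k₁ ‖x‖ + (‖x‖ : ℂ)⁻¹ * k₂ ‖x‖)
        * (x j : ℂ) ^ 2 := by
    intro j
    have hPj : DifferentiableAt ℝ (fun y => fderiv ℝ P y (EuclideanSpace.single j 1)) x :=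
      ((hP.fderiv_right (m := 1) (by norm_num)).differentiable (by norm_num) x).clm_apply
        (differentiableAt_const _)
    have hE : (fun y => fderiv ℝ (fun y => P y * k ‖y‖) y (EuclideanSpace.single j 1)) =ᶠ[nhds x]
        fun y => fderiv ℝ P y (EuclideanSpace.single j 1) * k ‖y‖
          + (P y * (y j : ℂ)) * ((‖y‖ : ℂ)⁻¹ * k₁ ‖y‖) := by
      filter_upwards [isOpen_ne.mem_nhds hx] with y hy
      rw [fderiv_mul_comp_norm_single (hPd y) hy (hk _ (norm_pos_iff.2 hy)) j]
      ring
    obtain ⟨hc, hc'⟩ := fderiv_mul_coord_single (hPd x) j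
    have hd1 := (hPj.fun_mul (hasFDerivAt_comp_norm hx (hk _ hr)).differentiableAt)
    have hd2 := (hc.fun_mul (hasFDerivAt_comp_norm hx (hq _ hr)).differentiableAt)
    rw [hE.fderiv_eq, fderiv_fun_add hd1 hd2, add_apply,
      fderiv_mul_comp_norm_single hPj hx (hk _ hr) j,
      fderiv_mul_comp_norm_single (k := fun s : ℝ => (s : ℂ)⁻¹ * k₁ s) hc hx (hq _ hr) j, hc']
    ring
  have hsq : ∑ j, (x j : ℂ) ^ 2 = (‖x‖ : ℂ) ^ 2 := by
    have := EuclideanSpace.real_norm_sq_eq x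
    exact_mod_cast this.symm
  have hL : laplacian (fun y => P y * k ‖y‖) x = laplacian P x * k ‖x‖
      + 2 * (‖x‖ : ℂ)⁻¹ * k₁ ‖x‖ * (m * P x)
      + N * (P x * ((‖x‖ : ℂ)⁻¹ * k₁ ‖x‖))
      + P x * (‖x‖ : ℂ)⁻¹ * (-((‖x‖ : ℂ) ^ 2)⁻¹ * k₁ ‖x‖ + (‖x‖ : ℂ)⁻¹ * k₂ ‖x‖)
        * (‖x‖ : ℂ) ^ 2 := by
    rw [laplacian, Finset.sum_congr rfl fun j _ => key j]
    simp only [Finset.sum_add_distrib, Finset.sum_const, Finset.card_univ, Fintype.card_fin,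
      nsmul_eq_mul, ← Finset.sum_mul, ← Finset.mul_sum, hsq, sum_coord_mul_fderiv,
      fderiv_self_of_homogeneous hPd hPhom, laplacian]
  rw [hL]
  field_simp
  ring

theorem contDiff_mvPolynomial_eval {N : ℕ} {n : WithTop ℕ∞} (q : MvPolynomial (Fin N) ℂ) :
    ContDiff ℝ n fun x : EuclideanSpace ℝ (Fin N) => MvPolynomial.eval (fun j => (x j : ℂ)) q := by
  simp only [MvPolynomial.eval_eq]
  refine ContDiff.sum fun d _ => contDiff_const.mul (contDiff_prod fun j _ => ContDiff.pow ?_ _)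
  exact (Complex.ofRealCLM.comp
    (EuclideanSpace.proj j : EuclideanSpace ℝ (Fin N) →L[ℝ] ℝ)).contDiff

theorem stmt0 (N : ℕ) (hN : 1 ≤ N) (m : ℕ) (P : EuclideanSpace ℝ (Fin N) → ℂ)
    (f : ℝ → ℂ)
    -- `P` is a polynomial function
    (hPpoly : ∃ q : MvPolynomial (Fin N) ℂ,
      ∀ x : EuclideanSpace ℝ (Fin N), P x = MvPolynomial.eval (fun j => (x j : ℂ)) q)
    -- `P` is homogeneous of degree `m`
    (hPhom : ∀ (c : ℝ) (x : EuclideanSpace ℝ (Fin N)), 0 < c →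
      P (c • x) = (c : ℂ) ^ m * P x)
    -- `P` is harmonic on all of `ℝ^N`
    (hPharm : ∀ x : EuclideanSpace ℝ (Fin N), laplacian P x = 0)
    -- `f` is smooth on `(0, ∞)`
    (hf : ContDiffOn ℝ (⊤ : ℕ∞) f (Set.Ioi 0))
    (F : EuclideanSpace ℝ (Fin N) → ℂ)
    (hF : ∀ x : EuclideanSpace ℝ (Fin N), F x = P (‖x‖⁻¹ • x) * f ‖x‖) :
    ∀ x : EuclideanSpace ℝ (Fin N), x ≠ 0 →
      (‖x‖ : ℂ) ^ 2 * laplacian F x =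
        P (‖x‖⁻¹ • x) *
          ((‖x‖ : ℂ) ^ 2 * deriv (deriv f) ‖x‖
            + ((N : ℂ) - 1) * (‖x‖ : ℂ) * deriv f ‖x‖
            - (m : ℂ) * ((m : ℂ) + (N : ℂ) - 2) * f ‖x‖) := by
  intro x hx
  obtain ⟨q, hq⟩ := hPpoly
  have hP : ContDiff ℝ 2 P := (funext hq : P = _) ▸ contDiff_mvPolynomial_eval q
  have hr : (0 : ℝ) < ‖x‖ := norm_pos_iff.2 hx
  have hrc : (‖x‖ : ℂ) ≠ 0 := Complex.ofReal_ne_zero.2 hr.ne'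
  have hf₁ : ∀ r, 0 < r → HasDerivAt f (deriv f r) r := fun r hr =>
    ((hf.differentiableOn (by simp)).differentiableAt (Ioi_mem_nhds hr)).hasDerivAt
  have hf₂ : ∀ r, 0 < r → HasDerivAt (deriv f) (deriv (deriv f) r) r := fun r hr =>
    (((hf.deriv_of_isOpen (m := 1) isOpen_Ioi (WithTop.coe_le_coe.2 le_top)).differentiableOn
      (by simp)).differentiableAt (Ioi_mem_nhds hr)).hasDerivAt
  have hz : ∀ (n : ℤ) (r : ℝ), 0 < r →
      HasDerivAt (fun s : ℝ => (s : ℂ) ^ n) (n * (r : ℂ) ^ (n - 1)) r := fun n r hr =>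
    (hasDerivAt_zpow n (r : ℂ) (Or.inl (Complex.ofReal_ne_zero.2 hr.ne'))).comp_ofReal
  have hk : ∀ r : ℝ, 0 < r → HasDerivAt (fun s : ℝ => (s : ℂ) ^ (-m : ℤ) * f s) _ r :=
    fun r hr => (hz _ r hr).mul (hf₁ r hr)
  have hk₁ : ∀ r : ℝ, 0 < r → HasDerivAt (fun s : ℝ =>
      ((-m : ℤ) : ℂ) * (s : ℂ) ^ (-m - 1 : ℤ) * f s + (s : ℂ) ^ (-m : ℤ) * deriv f s) _ r :=
    fun r hr => (((hz _ r hr).const_mul _).mul (hf₁ r hr)).add ((hz _ r hr).mul (hf₂ r hr))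
  have hhom : ∀ y : EuclideanSpace ℝ (Fin N), y ≠ 0 →
      P (‖y‖⁻¹ • y) = (‖y‖ : ℂ) ^ (-m : ℤ) * P y := by
    intro y hy
    rw [hPhom _ _ (inv_pos.2 (norm_pos_iff.2 hy))]
    simp
  have hFE : F =ᶠ[nhds x] fun y => P y * ((‖y‖ : ℂ) ^ (-m : ℤ) * f ‖y‖) := by
    filter_upwards [isOpen_ne.mem_nhds hx] with y hy
    rw [hF, hhom y hy]
    ring
  rw [laplacian_congr_nhds hFE, laplacian_mul_radial
    (k := fun s : ℝ => (s : ℂ) ^ (-m : ℤ) * f s) hP hPhom hk hk₁ hx, hPharm, hhom x hx]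
  simp only [zpow_sub₀ hrc, zpow_one]
  push_cast
  field_simp
  ring
end

section
/- Let N ≥ 1 and let a ∈ ℂ with a ≠ 0. For F : ℝ^N → ℂ smooth on ℝ^N \ {0}, define (H_a F)(x) = (2/a)·∑_{j=1}^N x_j ∂F/∂x_j(x) + ((a+N−2)/a)·F(x), (E⁺_a F)(x) = (i/a)·‖x‖^a·F(x), and (E⁻_a F)(x) = (i/a)·‖x‖^{2−a}·(ΔF)(x), where ‖x‖^w = exp(w·log‖x‖) for x ≠ 0. Then for every F smooth on ℝ^N \ {0} and every x ≠ 0: H_a(E⁺_a F)(x) − E⁺_a(H_a F)(x) = 2·(E⁺_a F)(x), H_a(E⁻_a F)(x) − E⁻_a(H_a F)(x) = −2·(E⁻_a F)(x), and E⁺_a(E⁻_a F)(x) − E⁻_a(E⁺_a F)(x) = (H_a F)(x). That is, H_a, E⁺_a, E⁻_a form an sl₂-triple of differential operators on ℝ^N \ {0}. -/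
/-- The operator `H_a = (2/a) ∑ xⱼ ∂ⱼ + (a + N - 2)/a`. -/
noncomputable def opH {N : ℕ} (a : ℂ) (F : EuclideanSpace ℝ (Fin N) → ℂ) :
    EuclideanSpace ℝ (Fin N) → ℂ :=
  fun x => (2 / a) * fderiv ℝ F x x + ((a + (N : ℂ) - 2) / a) * F x

/-- The operator `E⁺_a = (i/a) ‖x‖^a`. -/
noncomputable def opEp {N : ℕ} (a : ℂ) (F : EuclideanSpace ℝ (Fin N) → ℂ) :
    EuclideanSpace ℝ (Fin N) → ℂ :=
  fun x => (Complex.I / a) * (‖x‖ : ℂ) ^ a * F x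

/-- The operator `E⁻_a = (i/a) ‖x‖^(2-a) Δ`. -/
noncomputable def opEm {N : ℕ} (a : ℂ) (F : EuclideanSpace ℝ (Fin N) → ℂ) :
    EuclideanSpace ℝ (Fin N) → ℂ :=
  fun x => (Complex.I / a) * (‖x‖ : ℂ) ^ (2 - a) * laplacian F x

/-- The partial derivative `∂G/∂xⱼ`. -/
noncomputable def partialDeriv {N : ℕ} (j : Fin N) (G : EuclideanSpace ℝ (Fin N) → ℂ) :
    EuclideanSpace ℝ (Fin N) → ℂ :=
  fun x => fderiv ℝ G x (EuclideanSpace.single j 1)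

/-- Smoothness on the complement of the origin. -/
def SmoothOffZero {N : ℕ} (G : EuclideanSpace ℝ (Fin N) → ℂ) : Prop :=
  ContDiffOn ℝ (⊤ : ℕ∞) G {(0 : EuclideanSpace ℝ (Fin N))}ᶜ

section PuncturedCalculus

variable {N : ℕ} {F G : EuclideanSpace ℝ (Fin N) → ℂ} {x : EuclideanSpace ℝ (Fin N)}

namespace SmoothOffZero

theorem contDiffAt (hG : SmoothOffZero G) (hx : x ≠ 0) : ContDiffAt ℝ (⊤ : ℕ∞) G x :=
  ContDiffOn.contDiffAt hG (isOpen_compl_singleton.mem_nhds hx)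

theorem differentiableAt (hG : SmoothOffZero G) (hx : x ≠ 0) : DifferentiableAt ℝ G x :=
  (hG.contDiffAt hx).differentiableAt (by simp)

theorem of_contDiffAt (h : ∀ x, x ≠ 0 → ContDiffAt ℝ (⊤ : ℕ∞) G x) : SmoothOffZero G :=
  fun x hx => (h x hx).contDiffWithinAt

theorem mul (hF : SmoothOffZero F) (hG : SmoothOffZero G) :
    SmoothOffZero (fun y => F y * G y) :=
  ContDiffOn.mul hF hG

theorem const (c : ℂ) : SmoothOffZero (fun _ : EuclideanSpace ℝ (Fin N) => c) :=
  contDiffOn_const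

theorem add (hF : SmoothOffZero F) (hG : SmoothOffZero G) :
    SmoothOffZero (fun y => F y + G y) :=
  ContDiffOn.add hF hG

theorem sum {ι : Type*} {s : Finset ι} {f : ι → EuclideanSpace ℝ (Fin N) → ℂ}
    (hf : ∀ i ∈ s, SmoothOffZero (f i)) : SmoothOffZero (fun y => ∑ i ∈ s, f i y) :=
  ContDiffOn.sum hf

theorem partialDeriv (hG : SmoothOffZero G) (j : Fin N) :
    SmoothOffZero (partialDeriv j G) :=
  of_contDiffAt fun _ hx =>
    ((hG.contDiffAt hx).fderiv_right (m := (⊤ : ℕ∞)) (by simp)).clm_apply contDiffAt_const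

theorem coord (i : Fin N) :
    SmoothOffZero (fun y : EuclideanSpace ℝ (Fin N) => ((y i : ℝ) : ℂ)) :=
  (Complex.ofRealCLM.contDiff.comp
    (EuclideanSpace.proj i : EuclideanSpace ℝ (Fin N) →L[ℝ] ℝ).contDiff).contDiffOn

theorem laplacian (hG : SmoothOffZero G) : SmoothOffZero (laplacian G) :=
  sum fun j _ => (hG.partialDeriv j).partialDeriv j

end SmoothOffZero

theorem partialDeriv_congr (h : ∀ y, y ≠ 0 → F y = G y) (hx : x ≠ 0) (j : Fin N) :
    partialDeriv j F x = partialDeriv j G x := by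
  have : F =ᶠ[nhds x] G := by
    filter_upwards [isOpen_compl_singleton.mem_nhds hx] with y hy using h y hy
  simp only [partialDeriv, this.fderiv_eq]

theorem partialDeriv_mul (hF : SmoothOffZero F) (hG : SmoothOffZero G) (hx : x ≠ 0)
    (j : Fin N) :
    partialDeriv j (fun y => F y * G y) x =
      partialDeriv j F x * G x + F x * partialDeriv j G x := by
  simp only [partialDeriv, fderiv_fun_mul (hF.differentiableAt hx) (hG.differentiableAt hx)]
  simp
  ring

theorem partialDeriv_add (hF : SmoothOffZero F) (hG : SmoothOffZero G) (hx : x ≠ 0)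
    (j : Fin N) :
    partialDeriv j (fun y => F y + G y) x = partialDeriv j F x + partialDeriv j G x := by
  simp [partialDeriv, fderiv_fun_add (hF.differentiableAt hx) (hG.differentiableAt hx)]

theorem partialDeriv_const (c : ℂ) (j : Fin N) :
    partialDeriv j (fun _ => c) x = 0 := by
  simp [partialDeriv]

theorem partialDeriv_const_mul (hG : SmoothOffZero G) (c : ℂ) (hx : x ≠ 0) (j : Fin N) :
    partialDeriv j (fun y => c * G y) x = c * partialDeriv j G x := by
  rw [partialDeriv_mul (.const c) hG hx, partialDeriv_const]
  ring

theorem partialDeriv_sum {ι : Type*} {s : Finset ι} {f : ι → EuclideanSpace ℝ (Fin N) → ℂ}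
    (hf : ∀ i ∈ s, SmoothOffZero (f i)) (hx : x ≠ 0) (j : Fin N) :
    partialDeriv j (fun y => ∑ i ∈ s, f i y) x = ∑ i ∈ s, partialDeriv j (f i) x := by
  simp [partialDeriv, fderiv_fun_sum fun i hi => (hf i hi).differentiableAt hx]

theorem partialDeriv_coord (i j : Fin N) :
    partialDeriv j (fun y => ((y i : ℝ) : ℂ)) x = if i = j then 1 else 0 := by
  have h : HasFDerivAt (fun y : EuclideanSpace ℝ (Fin N) => ((y i : ℝ) : ℂ))
      (Complex.ofRealCLM.comp (EuclideanSpace.proj i : EuclideanSpace ℝ (Fin N) →L[ℝ] ℝ)) x :=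
    (Complex.ofRealCLM.comp
      (EuclideanSpace.proj i : EuclideanSpace ℝ (Fin N) →L[ℝ] ℝ)).hasFDerivAt
  rw [partialDeriv, h.fderiv]
  by_cases hij : i = j <;> simp [hij]

theorem partialDeriv_comm (hG : SmoothOffZero G) (hx : x ≠ 0) (i j : Fin N) :
    partialDeriv i (partialDeriv j G) x = partialDeriv j (partialDeriv i G) x := by
  have hd : DifferentiableAt ℝ (fderiv ℝ G) x :=
    ((hG.contDiffAt hx).fderiv_right (m := (⊤ : ℕ∞)) (by simp)).differentiableAt (by simp)
  have key : ∀ i j : Fin N, partialDeriv i (partialDeriv j G) x =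
      fderiv ℝ (fderiv ℝ G) x (EuclideanSpace.single i 1) (EuclideanSpace.single j 1) := by
    intro i j
    change fderiv ℝ (fun y => fderiv ℝ G y (EuclideanSpace.single j 1)) x _ = _
    rw [fderiv_clm_apply hd (differentiableAt_const _)]
    simp
  rw [key, key]
  exact ((hG.contDiffAt hx).isSymmSndFDerivAt
    (by simp only [minSmoothness_of_isRCLikeNormedField]; exact WithTop.coe_le_coe.2 le_top)).eq _ _

theorem fderiv_self_eq_sum (G : EuclideanSpace ℝ (Fin N) → ℂ) (x : EuclideanSpace ℝ (Fin N)) :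
    fderiv ℝ G x x = ∑ j, (x j : ℂ) * partialDeriv j G x := by
  have hx : x = ∑ j, x j • EuclideanSpace.single j (1 : ℝ) := by
    simpa using ((EuclideanSpace.basisFun (Fin N) ℝ).sum_repr x).symm
  have h := congrArg (fderiv ℝ G x) hx
  rw [map_sum] at h
  simpa [partialDeriv] using h

theorem laplacian_eq_sum (G : EuclideanSpace ℝ (Fin N) → ℂ) (x : EuclideanSpace ℝ (Fin N)) :
    laplacian G x = ∑ j, partialDeriv j (partialDeriv j G) x := rfl

theorem hasFDerivAt_norm_cpow (w : ℂ) (hx : x ≠ 0) :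
    HasFDerivAt (fun y : EuclideanSpace ℝ (Fin N) => (‖y‖ : ℂ) ^ w)
      ((w * (‖x‖ : ℂ) ^ (w - 2)) • Complex.ofRealCLM.comp (innerSL ℝ x)) x := by
  have hn : ‖x‖ ≠ 0 := norm_ne_zero_iff.2 hx
  have hnorm : HasFDerivAt (fun y : EuclideanSpace ℝ (Fin N) => ‖y‖) (‖x‖⁻¹ • innerSL ℝ x) x := by
    have h := (hasStrictFDerivAt_norm_sq x).hasFDerivAt.sqrt (pow_ne_zero 2 hn)
    simp only [Real.sqrt_sq (norm_nonneg _)] at h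
    refine h.congr_fderiv ?_
    ext v
    simp
    field_simp
  have hpow : HasDerivAt (fun t : ℝ => (t : ℂ) ^ w) (w * (‖x‖ : ℂ) ^ (w - 1)) ‖x‖ := by
    have h := ((hasDerivAt_id (‖x‖ : ℂ)).cpow_const (c := w)
      (by simpa using hx)).comp_ofReal
    simpa using h
  refine (hpow.hasFDerivAt.comp x hnorm).congr_fderiv ?_
  ext v
  have hc : (‖x‖ : ℂ) ≠ 0 := by simpa using hx
  have h2 : (‖x‖ : ℂ) ^ (w - 1) = (‖x‖ : ℂ) ^ (w - 2) * ‖x‖ := by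
    rw [show w - 1 = w - 2 + 1 by ring, Complex.cpow_add _ _ hc, Complex.cpow_one]
  simp [h2]
  field_simp

theorem SmoothOffZero.norm_cpow (w : ℂ) :
    SmoothOffZero (fun y : EuclideanSpace ℝ (Fin N) => (‖y‖ : ℂ) ^ w) := by
  refine .of_contDiffAt fun x hx => ?_
  have h : ContDiffAt ℝ (⊤ : ℕ∞) (fun z : ℂ => z ^ w) (‖x‖ : ℂ) :=
    (analyticAt_id.cpow analyticAt_const (by simpa using hx)).contDiffAt.restrict_scalars ℝ
  exact h.comp x (Complex.ofRealCLM.contDiff.contDiffAt.comp x (contDiffAt_norm ℝ hx))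

theorem partialDeriv_norm_cpow (w : ℂ) (hx : x ≠ 0) (j : Fin N) :
    partialDeriv j (fun y => (‖y‖ : ℂ) ^ w) x = w * (‖x‖ : ℂ) ^ (w - 2) * (x j : ℂ) := by
  rw [partialDeriv, (hasFDerivAt_norm_cpow w hx).fderiv]
  simp [EuclideanSpace.inner_single_right]

theorem sum_coord_sq (x : EuclideanSpace ℝ (Fin N)) :
    ∑ j, (x j : ℂ) * (x j : ℂ) = (‖x‖ : ℂ) ^ 2 := by
  rw [← Complex.ofReal_pow, EuclideanSpace.real_norm_sq_eq]
  simp [pow_two]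

theorem norm_sq_mul_norm_cpow (w : ℂ) (hx : x ≠ 0) :
    (‖x‖ : ℂ) ^ 2 * (‖x‖ : ℂ) ^ (w - 2) = (‖x‖ : ℂ) ^ w := by
  have h : (‖x‖ : ℂ) ≠ 0 := by simpa using hx
  rw [← Complex.cpow_ofNat, ← Complex.cpow_add _ _ h]
  congr 1
  ring

theorem SmoothOffZero.euler (hG : SmoothOffZero G) : SmoothOffZero (fun y => fderiv ℝ G y y) := by
  simp only [fderiv_self_eq_sum]
  exact .sum fun i _ => (SmoothOffZero.coord i).mul (hG.partialDeriv i)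

theorem euler_norm_cpow_mul (hG : SmoothOffZero G) (c w : ℂ) (hx : x ≠ 0) :
    fderiv ℝ (fun y => c * (‖y‖ : ℂ) ^ w * G y) x x =
      c * (‖x‖ : ℂ) ^ w * (w * G x + fderiv ℝ G x x) := by
  have h := fun j : Fin N => partialDeriv_mul
    ((SmoothOffZero.const c).mul (.norm_cpow w)) hG hx j
  simp only [fderiv_self_eq_sum, h, partialDeriv_const_mul (.norm_cpow w) c hx,
    partialDeriv_norm_cpow w hx]
  have hw : c * (‖x‖ : ℂ) ^ w * (w * G x) =
      ∑ j, c * w * (‖x‖ : ℂ) ^ (w - 2) * G x * ((x j : ℂ) * (x j : ℂ)) := by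
    rw [← Finset.mul_sum, sum_coord_sq, ← norm_sq_mul_norm_cpow w hx]
    ring
  rw [mul_add, hw, Finset.mul_sum, ← Finset.sum_add_distrib]
  exact Finset.sum_congr rfl fun j _ => by ring

theorem laplacian_const_mul (hG : SmoothOffZero G) (c : ℂ) (hx : x ≠ 0) :
    laplacian (fun y => c * G y) x = c * laplacian G x := by
  rw [laplacian_eq_sum, laplacian_eq_sum, Finset.mul_sum]
  refine Finset.sum_congr rfl fun j _ => ?_
  rw [partialDeriv_congr (fun y hy => partialDeriv_const_mul hG c hy j) hx,
    partialDeriv_const_mul (hG.partialDeriv j) c hx]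

theorem laplacian_add (hF : SmoothOffZero F) (hG : SmoothOffZero G) (hx : x ≠ 0) :
    laplacian (fun y => F y + G y) x = laplacian F x + laplacian G x := by
  simp only [laplacian_eq_sum, ← Finset.sum_add_distrib]
  refine Finset.sum_congr rfl fun j _ => ?_
  rw [partialDeriv_congr (fun y hy => partialDeriv_add hF hG hy j) hx,
    partialDeriv_add (hF.partialDeriv j) (hG.partialDeriv j) hx]

theorem laplacian_mul (hF : SmoothOffZero F) (hG : SmoothOffZero G) (hx : x ≠ 0) :
    laplacian (fun y => F y * G y) x =
      laplacian F x * G x + 2 * ∑ j, partialDeriv j F x * partialDeriv j G x +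
        F x * laplacian G x := by
  simp only [laplacian_eq_sum, Finset.mul_sum, Finset.sum_mul, ← Finset.sum_add_distrib]
  refine Finset.sum_congr rfl fun j _ => ?_
  rw [partialDeriv_congr (fun y hy => partialDeriv_mul hF hG hy j) hx,
    partialDeriv_add ((hF.partialDeriv j).mul hG) (hF.mul (hG.partialDeriv j)) hx,
    partialDeriv_mul (hF.partialDeriv j) hG hx, partialDeriv_mul hF (hG.partialDeriv j) hx]
  ring

theorem laplacian_coord (i : Fin N) :
    laplacian (fun y => ((y i : ℝ) : ℂ)) x = 0 := by
  rw [laplacian_eq_sum]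
  refine Finset.sum_eq_zero fun j _ => ?_
  rw [show partialDeriv j (fun y => ((y i : ℝ) : ℂ)) = fun _ => if i = j then 1 else 0 from
    funext fun y => partialDeriv_coord i j, partialDeriv_const]

theorem laplacian_norm_cpow (w : ℂ) (hx : x ≠ 0) :
    laplacian (fun y => (‖y‖ : ℂ) ^ w) x = w * (w + N - 2) * (‖x‖ : ℂ) ^ (w - 2) := by
  have h (j : Fin N) : partialDeriv j (partialDeriv j fun y => (‖y‖ : ℂ) ^ w) x =
      w * (w - 2) * (‖x‖ : ℂ) ^ (w - 2 - 2) * ((x j : ℂ) * (x j : ℂ)) +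
        w * (‖x‖ : ℂ) ^ (w - 2) := by
    rw [partialDeriv_congr (fun y hy => partialDeriv_norm_cpow w hy j) hx,
      partialDeriv_mul ((SmoothOffZero.const w).mul (.norm_cpow _)) (.coord j) hx,
      partialDeriv_const_mul (.norm_cpow _) w hx, partialDeriv_norm_cpow _ hx,
      partialDeriv_coord]
    simp only [if_true]
    ring
  simp only [laplacian_eq_sum, h, Finset.sum_add_distrib, ← Finset.mul_sum, sum_coord_sq]
  rw [← norm_sq_mul_norm_cpow (w - 2) hx]
  simp
  ring

theorem partialDeriv_laplacian (hG : SmoothOffZero G) (hx : x ≠ 0) (i : Fin N) :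
    partialDeriv i (laplacian G) x = laplacian (partialDeriv i G) x := by
  change partialDeriv i (fun y => ∑ j, partialDeriv j (partialDeriv j G) y) x = _
  rw [partialDeriv_sum (fun j _ => (hG.partialDeriv j).partialDeriv j) hx, laplacian_eq_sum]
  refine Finset.sum_congr rfl fun j _ => ?_
  rw [partialDeriv_comm (hG.partialDeriv j) hx,
    partialDeriv_congr (fun y hy => partialDeriv_comm hG hy i j) hx]

theorem laplacian_sum {ι : Type*} {s : Finset ι} {f : ι → EuclideanSpace ℝ (Fin N) → ℂ}
    (hf : ∀ i ∈ s, SmoothOffZero (f i)) (hx : x ≠ 0) :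
    laplacian (fun y => ∑ i ∈ s, f i y) x = ∑ i ∈ s, laplacian (f i) x := by
  simp only [laplacian_eq_sum]
  rw [Finset.sum_comm]
  refine Finset.sum_congr rfl fun j _ => ?_
  rw [partialDeriv_congr (fun y hy => partialDeriv_sum hf hy j) hx,
    partialDeriv_sum (fun i hi => (hf i hi).partialDeriv j) hx]

theorem laplacian_euler (hG : SmoothOffZero G) (hx : x ≠ 0) :
    laplacian (fun y => fderiv ℝ G y y) x =
      fderiv ℝ (laplacian G) x x + 2 * laplacian G x := by
  simp only [fderiv_self_eq_sum]
  rw [laplacian_sum (fun i _ => (SmoothOffZero.coord i).mul (hG.partialDeriv i)) hx,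
    laplacian_eq_sum G x, Finset.mul_sum, ← Finset.sum_add_distrib]
  refine Finset.sum_congr rfl fun i _ => ?_
  rw [laplacian_mul (.coord i) (hG.partialDeriv i) hx, laplacian_coord,
    partialDeriv_laplacian hG hx]
  simp only [partialDeriv_coord, ite_mul, one_mul, zero_mul, Finset.sum_ite_eq,
    Finset.mem_univ, if_true]
  ring

theorem laplacian_norm_cpow_mul (hG : SmoothOffZero G) (w : ℂ) (hx : x ≠ 0) :
    laplacian (fun y => (‖y‖ : ℂ) ^ w * G y) x =
      w * (‖x‖ : ℂ) ^ (w - 2) * ((w + N - 2) * G x + 2 * fderiv ℝ G x x) +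
        (‖x‖ : ℂ) ^ w * laplacian G x := by
  rw [laplacian_mul (.norm_cpow w) hG hx, laplacian_norm_cpow w hx, fderiv_self_eq_sum]
  simp only [partialDeriv_norm_cpow w hx, mul_assoc, ← Finset.mul_sum]
  ring

/-- Conjugating `H_a` by multiplication with `c ‖x‖ ^ w` shifts it by `2w/a`. -/
theorem opH_norm_cpow_mul (hG : SmoothOffZero G) (a c w : ℂ) (hx : x ≠ 0) :
    opH a (fun y => c * (‖y‖ : ℂ) ^ w * G y) x =
      c * (‖x‖ : ℂ) ^ w * (2 / a * w * G x + opH a G x) := by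
  rw [opH, euler_norm_cpow_mul hG c w hx, opH]
  ring

theorem laplacian_opH (hG : SmoothOffZero G) (a : ℂ) (hx : x ≠ 0) :
    laplacian (opH a G) x = opH a (laplacian G) x + 4 / a * laplacian G x := by
  unfold opH
  rw [laplacian_add ((SmoothOffZero.const _).mul hG.euler) ((SmoothOffZero.const _).mul hG) hx,
    laplacian_const_mul hG.euler _ hx, laplacian_const_mul hG _ hx, laplacian_euler hG hx]
  ring

theorem laplacian_opEp (hG : SmoothOffZero G) {a : ℂ} (ha : a ≠ 0) (hx : x ≠ 0) :
    laplacian (opEp a G) x = Complex.I / a *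
      (a ^ 2 * (‖x‖ : ℂ) ^ (a - 2) * opH a G x + (‖x‖ : ℂ) ^ a * laplacian G x) := by
  unfold opEp opH
  simp only [mul_assoc (Complex.I / a)]
  rw [laplacian_const_mul ((SmoothOffZero.norm_cpow a).mul hG) _ hx,
    laplacian_norm_cpow_mul hG a hx]
  field_simp
  ring

end PuncturedCalculus

theorem stmt2 (N : ℕ) (hN : 1 ≤ N) (a : ℂ) (ha : a ≠ 0)
    (F : EuclideanSpace ℝ (Fin N) → ℂ)
    (hF : ContDiffOn ℝ (⊤ : ℕ∞) F {(0 : EuclideanSpace ℝ (Fin N))}ᶜ) :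
    ∀ x : EuclideanSpace ℝ (Fin N), x ≠ 0 →
      opH a (opEp a F) x - opEp a (opH a F) x = 2 * opEp a F x ∧
      opH a (opEm a F) x - opEm a (opH a F) x = -2 * opEm a F x ∧
      opEp a (opEm a F) x - opEm a (opEp a F) x = opH a F x := by
  intro x hx
  have hF' : SmoothOffZero F := hF
  refine ⟨?_, ?_, ?_⟩
  · change opH a (fun y => Complex.I / a * (‖y‖ : ℂ) ^ a * F y) x - _ = _
    rw [opH_norm_cpow_mul hF' a _ a hx]
    unfold opEp
    field_simp
    ring
  · change opH a (fun y => Complex.I / a * (‖y‖ : ℂ) ^ (2 - a) * laplacian F y) x - _ = _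
    rw [opH_norm_cpow_mul hF'.laplacian a _ (2 - a) hx]
    unfold opEm
    rw [laplacian_opH hF' a hx]
    field_simp
    ring
  · have h : (‖x‖ : ℂ) ≠ 0 := by simpa using hx
    have hp : (‖x‖ : ℂ) ^ (2 - a) * (‖x‖ : ℂ) ^ (a - 2) = 1 := by
      rw [← Complex.cpow_add _ _ h]
      simp
    unfold opEm
    rw [laplacian_opEp hF' ha hx]
    unfold opEp
    have hI : Complex.I / a * (Complex.I / a) * a ^ 2 = -1 := by
      field_simp
      simp
    linear_combination (-(Complex.I / a * (Complex.I / a) * a ^ 2) * opH a F x) * hp -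
      opH a F x * hI
end

section
/- Let N ≥ 1, let m be a natural number, and let a ∈ ℂ with a ≠ 0. For f : ℝ → ℂ smooth on (0,∞), define (H_a^{(m)} f)(r) = (2/a)·r·f′(r) + ((a+N−2)/a)·f(r), (E⁺_a^{(m)} f)(r) = (i/a)·r^a·f(r), and (E⁻_a^{(m)} f)(r) = (i/a)·r^{−a}·( r²f″(r) + (N−1)r f′(r) − m(m+N−2)f(r) ), where r^w = exp(w·log r) for r > 0. Then for every f smooth on (0,∞) and every r > 0: H_a^{(m)}(E⁺_a^{(m)} f)(r) − E⁺_a^{(m)}(H_a^{(m)} f)(r) = 2·(E⁺_a^{(m)} f)(r), H_a^{(m)}(E⁻_a^{(m)} f)(r) − E⁻_a^{(m)}(H_a^{(m)} f)(r) = −2·(E⁻_a^{(m)} f)(r), and E⁺_a^{(m)}(E⁻_a^{(m)} f)(r) − E⁻_a^{(m)}(E⁺_a^{(m)} f)(r) = (H_a^{(m)} f)(r). That is, H_a^{(m)}, E⁺_a^{(m)}, E⁻_a^{(m)} form an sl₂-triple of differential operators on (0,∞). -/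
/-- The radial operator `H_a^(m) = (2/a) ϑ + (a + N - 2)/a`, where `ϑ = r d/dr`. -/
noncomputable def radH (N : ℕ) (a : ℂ) (f : ℝ → ℂ) : ℝ → ℂ :=
  fun r => (2 / a) * ((r : ℂ) * deriv f r) + ((a + (N : ℂ) - 2) / a) * f r

/-- The radial operator `E⁺_a^(m) = (i/a) r^a`. -/
noncomputable def radEp (a : ℂ) (f : ℝ → ℂ) : ℝ → ℂ :=
  fun r => (Complex.I / a) * (r : ℂ) ^ a * f r

/-- The radial operator
`E⁻_a^(m) = (i/a) r^(-a) (ϑ - m)(ϑ + m + N - 2)`, where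
`(ϑ - m)(ϑ + m + N - 2) f (r) = r² f″(r) + (N-1) r f′(r) - m(m+N-2) f(r)`. -/
noncomputable def radEm (N : ℕ) (m : ℕ) (a : ℂ) (f : ℝ → ℂ) : ℝ → ℂ :=
  fun r => (Complex.I / a) * (r : ℂ) ^ (-a) *
    ((r : ℂ) ^ 2 * deriv (deriv f) r + ((N : ℂ) - 1) * (r : ℂ) * deriv f r
      - (m : ℂ) * ((m : ℂ) + (N : ℂ) - 2) * f r)

/-- A smooth function on `(0,∞)` is differentiable there, with smooth derivative. -/
theorem ContDiffOn.hasDerivAt_and_deriv_Ioi {f : ℝ → ℂ}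
    (hf : ContDiffOn ℝ (⊤ : ℕ∞) f (Set.Ioi 0)) :
    (∀ x : ℝ, 0 < x → HasDerivAt f (deriv f x) x) ∧
      ContDiffOn ℝ (⊤ : ℕ∞) (deriv f) (Set.Ioi 0) := by
  refine ⟨fun x hx => ?_, hf.deriv_of_isOpen isOpen_Ioi (by simp)⟩
  exact ((hf.differentiableOn (by simp)).differentiableAt (Ioi_mem_nhds hx)).hasDerivAt

theorem hasDerivAt_ofReal_cpow_of_pos (w : ℂ) {x : ℝ} (hx : 0 < x) :
    HasDerivAt (fun y : ℝ => (y : ℂ) ^ w) (w * ((x : ℂ) ^ w / x)) x := by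
  have h : HasDerivAt (fun z : ℂ => z ^ w) (w * (x : ℂ) ^ (w - 1)) (x : ℂ) := by
    simpa using (hasDerivAt_id (x : ℂ)).cpow_const (c := w)
      (Complex.ofReal_mem_slitPlane.2 hx)
  rw [Complex.cpow_sub _ _ (by exact_mod_cast hx.ne'), Complex.cpow_one] at h
  exact h.comp_ofReal

theorem deriv_deriv_eq_of_pos {g g' : ℝ → ℂ} {c : ℂ} {r : ℝ} (hr : 0 < r)
    (h : ∀ x : ℝ, 0 < x → HasDerivAt g (g' x) x) (h' : HasDerivAt g' c r) :
    deriv (deriv g) r = c := by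
  have he : deriv g =ᶠ[nhds r] g' := by
    filter_upwards [Ioi_mem_nhds hr] with x hx using (h x hx).deriv
  rw [he.deriv_eq, h'.deriv]

section RadialDerivatives

variable {f f₁ f₂ f₃ : ℝ → ℂ} {x : ℝ}

theorem hasDerivAt_radH (N : ℕ) (a : ℂ) (h₀ : HasDerivAt f (f₁ x) x)
    (h₁ : HasDerivAt (deriv f) (f₂ x) x) :
    HasDerivAt (radH N a f)
      ((2 / a) * (deriv f x + x * f₂ x) + ((a + (N : ℂ) - 2) / a) * f₁ x) x := by
  have hx := (hasDerivAt_id (x : ℂ)).comp_ofReal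
  exact (((hx.mul h₁).const_mul (2 / a)).add (h₀.const_mul _)).congr_deriv (by simp)

theorem hasDerivAt_radEp (a : ℂ) (hx : 0 < x) (h₀ : HasDerivAt f (f₁ x) x) :
    HasDerivAt (radEp a f)
      ((Complex.I / a) * (a * ((x : ℂ) ^ a / x)) * f x + (Complex.I / a) * (x : ℂ) ^ a * f₁ x)
      x :=
  ((hasDerivAt_ofReal_cpow_of_pos a hx).const_mul (Complex.I / a)).mul h₀

theorem hasDerivAt_radEm (N m : ℕ) (a : ℂ) (hx : 0 < x) (h₀ : HasDerivAt f (deriv f x) x)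
    (h₁ : HasDerivAt (deriv f) (deriv (deriv f) x) x)
    (h₂ : HasDerivAt (deriv (deriv f)) (f₃ x) x) :
    HasDerivAt (radEm N m a f)
      ((Complex.I / a) * (-a * ((x : ℂ) ^ (-a) / x)) *
          ((x : ℂ) ^ 2 * deriv (deriv f) x + ((N : ℂ) - 1) * x * deriv f x
            - (m : ℂ) * ((m : ℂ) + (N : ℂ) - 2) * f x)
        + (Complex.I / a) * (x : ℂ) ^ (-a) *
          ((x : ℂ) ^ 2 * f₃ x + ((N : ℂ) + 1) * x * deriv (deriv f) x
            + ((N : ℂ) - 1 - (m : ℂ) * ((m : ℂ) + (N : ℂ) - 2)) * deriv f x)) x := by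
  have hX := (hasDerivAt_id (x : ℂ)).comp_ofReal
  have hP := (((hX.pow 2).mul h₂).add ((hX.const_mul ((N : ℂ) - 1)).mul h₁)).sub
    (h₀.const_mul ((m : ℂ) * ((m : ℂ) + (N : ℂ) - 2)))
  refine (((hasDerivAt_ofReal_cpow_of_pos (-a) hx).const_mul (Complex.I / a)).mul hP).congr_deriv
    ?_
  simp only [id, Pi.add_apply, Pi.sub_apply, Pi.mul_apply, Pi.pow_apply]
  push_cast
  ring

end RadialDerivatives

theorem stmt3 (N : ℕ) (hN : 1 ≤ N) (m : ℕ) (a : ℂ) (ha : a ≠ 0)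
    (f : ℝ → ℂ) (hf : ContDiffOn ℝ (⊤ : ℕ∞) f (Set.Ioi 0)) :
    ∀ r : ℝ, 0 < r →
      radH N a (radEp a f) r - radEp a (radH N a f) r = 2 * radEp a f r ∧
      radH N a (radEm N m a f) r - radEm N m a (radH N a f) r
        = -2 * radEm N m a f r ∧
      radEp a (radEm N m a f) r - radEm N m a (radEp a f) r = radH N a f r := by
  intro r hr
  obtain ⟨h₀, hf₁⟩ := hf.hasDerivAt_and_deriv_Ioi
  obtain ⟨h₁, hf₂⟩ := hf₁.hasDerivAt_and_deriv_Ioi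
  obtain ⟨h₂, -⟩ := hf₂.hasDerivAt_and_deriv_Ioi
  have hr0 : (r : ℂ) ≠ 0 := by exact_mod_cast hr.ne'
  have hra : (r : ℂ) ^ a ≠ 0 := by simp [Complex.cpow_eq_zero_iff, hr0]
  have hX := (hasDerivAt_id (r : ℂ)).comp_ofReal
  have hEp := (hasDerivAt_radEp a hr (h₀ r hr)).deriv
  have hEm := (hasDerivAt_radEm N m a hr (h₀ r hr) (h₁ r hr) (h₂ r hr)).deriv
  have hH := (hasDerivAt_radH N a (h₀ r hr) (h₁ r hr)).deriv
  have hHH := deriv_deriv_eq_of_pos hr (fun x hx => hasDerivAt_radH N a (h₀ x hx) (h₁ x hx))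
    ((((h₁ r hr).add (hX.mul (h₂ r hr))).const_mul (2 / a)).add ((h₁ r hr).const_mul _))
  have hcpow := hasDerivAt_ofReal_cpow_of_pos a hr
  have hEpEp := deriv_deriv_eq_of_pos hr (fun x hx => hasDerivAt_radEp a hx (h₀ x hx))
    ((((((hcpow.div hX hr0).const_mul a).const_mul (Complex.I / a)).mul (h₀ r hr))).add
      ((hcpow.const_mul (Complex.I / a)).mul (h₁ r hr)))
  simp only [id, Pi.div_apply, one_mul, mul_one] at hHH hEpEp
  refine ⟨?_, ?_, ?_⟩
  · rw [radH, hEp]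
    simp only [radEp, radH]
    field_simp
    ring
  · rw [radH, hEm]
    simp only [radEm, hHH, hH]
    simp only [radH]
    field_simp
    ring
  · rw [radEp, radEm, radEm, hEpEp, hEp]
    simp only [radEp, radH, Complex.cpow_neg]
    field_simp
    simp only [Complex.I_sq]
    ring
end

section
/- Let N ≥ 1 and let m be a natural number. Consider the complex Hilbert space H = L²((0,∞), r^{N−3}dr), and let D ⊆ H be the (dense) subspace of classes of smooth compactly supported functions on (0,∞). For real numbers c₁, c₂, c₃, let T : D → H be the densely defined linear operator T f = c₁·( 2r f′(r) + (N−2) f(r) ) + i·c₂·f(r) + i·c₃·( r²f″(r) + (N−1)r f′(r) − m(m+N−2) f(r) ). Then T is closable and its adjoint T* equals the negative of the closure of T; that is, every operator in the real span of 2ϑ+N−2, i, and i(ϑ−m)(ϑ+m+N−2) with domain C_c^∞((0,∞)) is essentially skew-adjoint on L²((0,∞), r^{N−3}dr). -/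
open MeasureTheory

/-- The measure `r^(N-3) dr` on `(0, ∞)`. -/
noncomputable def radMeasure (N : ℕ) : Measure ℝ :=
  (volume.restrict (Set.Ioi (0 : ℝ))).withDensity
    fun r => ENNReal.ofReal (r ^ ((N : ℝ) - 3))

/-- The formula for the differential operator
`c₁ (2ϑ + N - 2) + i c₂ + i c₃ (ϑ - m)(ϑ + m + N - 2)` acting on a function on `(0, ∞)`. -/
noncomputable def Tformula (N m : ℕ) (c₁ c₂ c₃ : ℝ) (f : ℝ → ℂ) : ℝ → ℂ :=
  fun r =>
    (c₁ : ℂ) * (2 * (r : ℂ) * deriv f r + ((N : ℂ) - 2) * f r)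
      + Complex.I * (c₂ : ℂ) * f r
      + Complex.I * (c₃ : ℂ) *
        ((r : ℂ) ^ 2 * deriv (deriv f) r + ((N : ℂ) - 1) * (r : ℂ) * deriv f r
          - (m : ℂ) * ((m : ℂ) + (N : ℂ) - 2) * f r)


/-! ### A criterion for essential skew-adjointness -/

section Abstract

variable {H : Type*} [NormedAddCommGroup H] [InnerProductSpace ℂ H]

theorem norm_le_norm_add_smul_of_skew {x y : H} (h : (inner ℂ y x).re = 0) :
    ‖x‖ ≤ ‖y + x‖ := by
  have h1 := norm_add_sq (𝕜 := ℂ) y x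
  simp only [RCLike.re_to_complex, h] at h1
  exact le_of_sq_le_sq (by nlinarith [sq_nonneg ‖y‖]) (norm_nonneg _)

/-- A densely defined skew-symmetric operator `T` such that `T + 1` and `T - 1` have dense range is
closable, and its adjoint is the negative of its closure. -/
theorem adjoint_eq_neg_closure_of_dense_range [CompleteSpace H] (T : H →ₗ.[ℂ] H)
    (hd : Dense (T.domain : Set H))
    (hskew : ∀ x y : T.domain, inner ℂ (T x) (y : H) = -inner ℂ (x : H) (T y))
    (hp : ∀ v : H, (∀ x : T.domain, inner ℂ v (T x + x) = 0) → v = 0)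
    (hm : ∀ v : H, (∀ x : T.domain, inner ℂ v (T x - x) = 0) → v = 0) :
    T.IsClosable ∧ T.adjoint = -T.closure := by
  have hle : -T ≤ T.adjoint := by
    apply LinearPMap.IsFormalAdjoint.le_adjoint hd
    intro x y
    rw [LinearPMap.neg_apply, inner_neg_right]
    exact hskew x y
  have hTadj : ∀ x : T.domain, ((x : H), -T x) ∈ T.adjoint.graph := fun x =>
    LinearPMap.le_graph_of_le hle ((-T).mem_graph x)
  have hcl : T.adjoint.IsClosed := LinearPMap.adjoint_isClosed hd
  have hsub : ∀ p : H × H, p ∈ T.graph.topologicalClosure → (p.1, -p.2) ∈ T.adjoint.graph := by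
    intro p hp
    have hc : _root_.IsClosed {p : H × H | (p.1, -p.2) ∈ T.adjoint.graph} :=
      _root_.IsClosed.preimage (f := fun p : H × H => (p.1, -p.2)) (by fun_prop) hcl
    refine closure_minimal ?_ hc hp
    rintro ⟨a, b⟩ hab
    obtain ⟨x, hx⟩ := (LinearPMap.mem_graph_iff' _).1 hab
    obtain ⟨rfl, rfl⟩ := Prod.mk.inj hx
    exact hTadj x
  have hclosable : T.IsClosable := by
    refine ⟨T.graph.topologicalClosure.toLinearPMap, ?_⟩
    rw [Submodule.toLinearPMap_graph_eq]
    intro p hp h0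
    have := hsub p hp
    rw [h0] at this
    simpa using T.adjoint.graph_fst_eq_zero_snd this rfl
  refine ⟨hclosable, ?_⟩
  apply LinearPMap.eq_of_eq_graph
  have hneg : ∀ p : H × H, p ∈ (-T.closure).graph ↔ (p.1, -p.2) ∈ T.closure.graph := by
    rintro ⟨a, b⟩
    simp only [LinearPMap.mem_graph_iff, LinearPMap.neg_domain, LinearPMap.neg_apply]
    exact exists_congr fun y => and_congr_right fun _ => neg_eq_iff_eq_neg
  ext ⟨y, w⟩
  rw [hneg, ← hclosable.graph_closure_eq_closure_graph]
  constructor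
  swap
  · intro h
    simpa using hsub _ h
  intro hyw
  obtain ⟨u, hu, huw⟩ := (LinearPMap.mem_graph_iff _).1 hyw
  simp only at hu huw
  -- the range of `T + 1` is dense
  let R : T.domain →ₗ[ℂ] H := T.toFun + T.domain.subtype
  have hR : Dense (LinearMap.range R : Set H) := by
    rw [Submodule.dense_iff_topologicalClosure_eq_top,
      Submodule.topologicalClosure_eq_top_iff, Submodule.eq_bot_iff]
    intro v hv
    refine hp v fun x => ?_
    exact (Submodule.mem_orthogonal' _ _).1 hv _ ⟨x, rfl⟩
  have hmem : (y - w) ∈ closure (LinearMap.range R : Set H) := hR _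
  obtain ⟨s, hs, hlim⟩ := mem_closure_iff_seq_limit.1 hmem
  choose x hx using hs
  have hbound : ∀ z : T.domain, ‖(z : H)‖ ≤ ‖R z‖ := by
    intro z
    refine norm_le_norm_add_smul_of_skew ?_
    have h1 := congrArg Complex.re (hskew z z)
    have h2 : (inner ℂ (z : H) (T z)).re = (inner ℂ (T z) (z : H)).re := inner_re_symm (𝕜 := ℂ) _ _
    simp only [Complex.neg_re] at h1
    change (inner ℂ (T z) (z : H)).re = 0
    linarith
  have hxc : CauchySeq fun n => (x n : H) := by
    have hsc := hlim.cauchySeq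
    rw [Metric.cauchySeq_iff] at hsc ⊢
    intro ε hε
    obtain ⟨n0, hn0⟩ := hsc ε hε
    refine ⟨n0, fun m hm n hn => lt_of_le_of_lt ?_ (hn0 m hm n hn)⟩
    rw [dist_eq_norm, dist_eq_norm, ← hx m, ← hx n, ← map_sub]
    exact hbound (x m - x n)
  obtain ⟨x₀, hx₀⟩ := cauchySeq_tendsto_of_complete hxc
  have hTx : Filter.Tendsto (fun n => T (x n)) Filter.atTop (nhds (y - w - x₀)) := by
    refine (hlim.sub hx₀).congr fun n => ?_
    rw [← hx n]
    exact add_sub_cancel_right _ _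
  have hgr : (x₀, y - w - x₀) ∈ T.graph.topologicalClosure :=
    mem_closure_of_tendsto (hx₀.prodMk_nhds hTx) (Filter.Eventually.of_forall fun n =>
      T.mem_graph (x n))
  have h3 := T.adjoint.graph.sub_mem hyw (hsub _ hgr)
  simp only [Prod.mk_sub_mk] at h3
  have h4 : w - -(y - w - x₀) = y - x₀ := by abel
  rw [h4] at h3
  obtain ⟨d, hd1, hd2⟩ := (LinearPMap.mem_graph_iff _).1 h3
  simp only at hd1 hd2
  have h5 : y - x₀ = 0 := by
    refine hm _ fun z => ?_
    have h6 := LinearPMap.adjoint_isFormalAdjoint hd d z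
    rw [hd2, hd1] at h6
    rw [inner_sub_right, ← h6, sub_self]
  rw [sub_eq_zero] at h5
  subst h5
  convert hgr using 2
  abel

end Abstract

/-! ### Bounded solutions of constant coefficient equations -/

theorem eq_zero_of_hasDerivAt_mul_of_bounded {k : ℝ → ℂ} {lam : ℂ} {C : ℝ}
    (hk : ∀ t, HasDerivAt k (lam * k t) t) (hb : ∀ t, ‖k t‖ ≤ C) (hlam : lam.re ≠ 0) :
    ∀ t, k t = 0 := by
  have hconst : ∀ s t : ℝ, Complex.exp (-lam * s) * k s = Complex.exp (-lam * t) * k t := by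
    have hd : ∀ t : ℝ, HasDerivAt (fun t : ℝ => Complex.exp (-lam * t) * k t) 0 t := by
      intro t
      have h1 : HasDerivAt (fun t : ℝ => -lam * (t : ℂ)) (-lam * 1) t :=
        (Complex.ofRealCLM.hasDerivAt (x := t)).const_mul (-lam)
      exact (h1.cexp.mul (hk t)).congr_deriv (by ring)
    exact is_const_of_deriv_eq_zero (fun t => (hd t).differentiableAt) fun t => (hd t).deriv
  intro t
  have hC : 0 ≤ C := (norm_nonneg _).trans (hb t)
  have hnorm : ∀ s : ℝ, ‖k t‖ ≤ Real.exp (lam.re * (t - s)) * C := by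
    intro s
    have h1 : k t = Complex.exp (lam * (t - s)) * k s := by
      have h2 := hconst s t
      have h3 : Complex.exp (lam * (t - s)) = Complex.exp (lam * t) * Complex.exp (-lam * s) := by
        rw [← Complex.exp_add]; ring_nf
      rw [h3, mul_assoc, h2, ← mul_assoc, ← Complex.exp_add]
      simp
    rw [h1, norm_mul, Complex.norm_exp]
    have h4 : (lam * ((t : ℂ) - s)).re = lam.re * (t - s) := by
      rw [← Complex.ofReal_sub, Complex.re_mul_ofReal]
    rw [h4]
    gcongr
    exact hb s
  have hlim : Filter.Tendsto (fun u : ℝ => Real.exp (-u) * C) Filter.atTop (nhds 0) := by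
    simpa using Real.tendsto_exp_neg_atTop_nhds_zero.mul_const C
  have h0 : ‖k t‖ ≤ 0 := by
    refine ge_of_tendsto' hlim fun u => ?_
    have := hnorm (t + u / lam.re)
    rwa [show lam.re * (t - (t + u / lam.re)) = -u by field_simp; ring] at this
  simpa using h0

/-- A bounded solution `h` with bounded derivative of `(i c D² + 2 a D + i b + σ) h = 0`, with `a`,
`b`, `c`, `σ` real and `σ ≠ 0`, vanishes, since no characteristic root is purely imaginary. -/
theorem eq_zero_of_bounded_of_hasDerivAt {h h' h'' : ℝ → ℂ} {a b c σ C C' : ℝ} (hσ : σ ≠ 0)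
    (hh : ∀ t, HasDerivAt h (h' t) t) (hh' : ∀ t, HasDerivAt h' (h'' t) t)
    (hb : ∀ t, ‖h t‖ ≤ C) (hb' : ∀ t, ‖h' t‖ ≤ C')
    (heq : ∀ t, Complex.I * c * h'' t + 2 * a * h' t + (Complex.I * b + σ) * h t = 0) :
    ∀ t, h t = 0 := by
  have hne : Complex.I * b + σ ≠ 0 := by
    intro h0
    have := congrArg Complex.re h0
    simp at this
    exact hσ this
  have hroot : ∀ z : ℂ, Complex.I * c * (z * z) + 2 * a * z + (Complex.I * b + σ) = 0 →
      z.re ≠ 0 := by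
    intro z hz h0
    have := congrArg Complex.re hz
    simp [h0] at this
    exact hσ this
  by_cases hc : c = 0
  · subst hc
    by_cases ha : a = 0
    · subst ha
      intro t
      simpa [hne] using heq t
    · have ha' : (a : ℂ) ≠ 0 := by exact_mod_cast ha
      refine eq_zero_of_hasDerivAt_mul_of_bounded (lam := -(Complex.I * b + σ) / (2 * a))
        (fun t => ?_) hb (hroot _ ?_)
      · refine (hh t).congr_deriv ?_
        have := heq t
        field_simp
        simp only [Complex.ofReal_zero, mul_zero, zero_mul, zero_add] at this
        linear_combination this
      · field_simp
        simp
  · have hc' : (c : ℂ) ≠ 0 := by exact_mod_cast hc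
    have hIc : Complex.I * c ≠ 0 := mul_ne_zero Complex.I_ne_zero hc'
    obtain ⟨z, hz⟩ := exists_quadratic_eq_zero (a := Complex.I * c) (b := 2 * (a : ℂ))
      (c := Complex.I * b + σ) hIc (by
        obtain ⟨s, hs⟩ := IsAlgClosed.exists_pow_nat_eq
          (discrim (Complex.I * c) (2 * (a : ℂ)) (Complex.I * b + σ)) (n := 2) two_pos
        exact ⟨s, by rw [← hs, sq]⟩)
    obtain ⟨y, hy⟩ : ∃ y, Complex.I * c * (z + y) = -(2 * a) :=
      ⟨-(2 * a) / (Complex.I * c) - z, by field_simp; ring⟩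
    have hzy : Complex.I * c * (z * y) = Complex.I * b + σ := by
      linear_combination z * hy - hz
    have hy' : Complex.I * c * (y * y) + 2 * a * y + (Complex.I * b + σ) = 0 := by
      linear_combination y * hy - hzy
    have hk := eq_zero_of_hasDerivAt_mul_of_bounded (k := fun t => h' t - y * h t) (lam := z)
      (C := C' + ‖y‖ * C) (fun t => ?_) (fun t => ?_) (hroot z hz)
    · refine eq_zero_of_hasDerivAt_mul_of_bounded (lam := y) (fun t => ?_) hb (hroot y hy')
      refine (hh t).congr_deriv ?_
      linear_combination hk t
    · refine ((hh' t).sub ((hh t).const_mul y)).congr_deriv ?_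
      apply mul_left_cancel₀ hIc
      linear_combination heq t - h' t * hy + h t * hzy
    · refine (norm_sub_le _ _).trans (add_le_add (hb' t) ?_)
      rw [norm_mul]
      exact mul_le_mul_of_nonneg_left (hb t) (norm_nonneg _)

/-! ### Test functions on the half-line -/

/-- Smooth functions with compact support in `(0, ∞)`. -/
structure IsTest (f : ℝ → ℂ) : Prop where
  contDiff : ContDiff ℝ (⊤ : ℕ∞) f
  hasCompactSupport : HasCompactSupport f
  tsupport_subset : tsupport f ⊆ Set.Ioi 0

/-- The operator `ϑ + (N - 2) / 2`. -/
noncomputable def symEuler (N : ℕ) (f : ℝ → ℂ) : ℝ → ℂ :=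
  fun r => (r : ℂ) * deriv f r + (((N : ℂ) - 2) / 2) * f r

/-- The dilation group on `L²((0, ∞), r^(N-3) dr)` generated by `symEuler N`. -/
noncomputable def dilate (N : ℕ) (t : ℝ) (f : ℝ → ℂ) : ℝ → ℂ :=
  fun r => (Real.exp (((N : ℝ) - 2) / 2 * t) : ℂ) * f (Real.exp t * r)

namespace IsTest

variable {f g : ℝ → ℂ}

theorem continuous (hf : IsTest f) : Continuous f := hf.contDiff.continuous

theorem hasDerivAt (hf : IsTest f) (r : ℝ) : HasDerivAt f (deriv f r) r :=
  (hf.contDiff.differentiable (by simp) r).hasDerivAt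

theorem mul_left (hf : IsTest f) {a : ℝ → ℂ} (ha : ContDiff ℝ (⊤ : ℕ∞) a) :
    IsTest fun r => a r * f r where
  contDiff := ha.mul hf.contDiff
  hasCompactSupport := hf.hasCompactSupport.mul_left
  tsupport_subset := (tsupport_mul_subset_right (f := a) (g := f)).trans hf.tsupport_subset

theorem const_mul (hf : IsTest f) (a : ℂ) : IsTest fun r => a * f r := hf.mul_left contDiff_const

theorem deriv (hf : IsTest f) : IsTest (deriv f) where
  contDiff := (contDiff_infty_iff_deriv.1 hf.contDiff).2
  hasCompactSupport := hf.hasCompactSupport.deriv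
  tsupport_subset := tsupport_deriv_subset.trans hf.tsupport_subset

theorem add (hf : IsTest f) (hg : IsTest g) : IsTest fun r => f r + g r where
  contDiff := hf.contDiff.add hg.contDiff
  hasCompactSupport := hf.hasCompactSupport.add hg.hasCompactSupport
  tsupport_subset := (tsupport_add f g).trans (Set.union_subset hf.tsupport_subset hg.tsupport_subset)

theorem symEuler (hf : IsTest f) (N : ℕ) : IsTest (symEuler N f) :=
  (hf.deriv.mul_left Complex.ofRealCLM.contDiff).add (hf.const_mul _)

theorem dilate (hf : IsTest f) (N : ℕ) (t : ℝ) : IsTest (dilate N t f) := by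
  have he : Real.exp t ≠ 0 := (Real.exp_pos t).ne'
  have h : IsTest fun r => f (Real.exp t * r) := by
    refine ⟨hf.contDiff.comp (contDiff_const.mul contDiff_id), ?_, ?_⟩
    · exact hf.hasCompactSupport.comp_homeomorph (Homeomorph.mulLeft₀ _ he)
    · intro r hr
      have h1 : Real.exp t * r ∈ tsupport f :=
        tsupport_comp_subset_preimage f (f := fun r => Real.exp t * r) (by fun_prop) hr
      exact pos_of_mul_pos_right (hf.tsupport_subset h1) (Real.exp_pos t).le
  exact h.const_mul _

theorem eq_zero_of_nonpos (hf : IsTest f) {r : ℝ} (hr : r ≤ 0) : f r = 0 :=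
  image_eq_zero_of_notMem_tsupport fun h => not_lt.2 hr (hf.tsupport_subset h)

/-- The support of a test function lies in some `[a, b]` with `0 < a`. -/
theorem exists_support_subset_Icc (hf : IsTest f) :
    ∃ a b : ℝ, 0 < a ∧ ∀ r, f r ≠ 0 → r ∈ Set.Icc a b := by
  have hK : IsCompact (insert 1 (tsupport f)) := hf.hasCompactSupport.insert 1
  obtain ⟨a, ha, hab⟩ := hK.exists_isLeast ⟨1, Set.mem_insert _ _⟩
  obtain ⟨b, hb, hbb⟩ := hK.exists_isGreatest ⟨1, Set.mem_insert _ _⟩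
  refine ⟨a, b, ?_, fun r hr => ?_⟩
  · rcases ha with rfl | ha
    · exact one_pos
    · exact hf.tsupport_subset ha
  · have : r ∈ insert 1 (tsupport f) := Or.inr (subset_tsupport f hr)
    exact ⟨hab this, hbb this⟩

end IsTest

theorem symEuler_dilate {f : ℝ → ℂ} (hf : IsTest f) (N : ℕ) (t : ℝ) :
    symEuler N (dilate N t f) = dilate N t (symEuler N f) := by
  funext r
  have h : HasDerivAt (dilate N t f) ((Real.exp (((N : ℝ) - 2) / 2 * t) : ℂ) *
      (Real.exp t • deriv f (Real.exp t * r))) r := by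
    have h1 : HasDerivAt (fun r => Real.exp t * r) (Real.exp t) r := by
      simpa using (hasDerivAt_id r).const_mul (Real.exp t)
    exact ((hf.hasDerivAt (Real.exp t * r)).scomp r h1).const_mul _
  simp only [symEuler, h.deriv, dilate, Complex.real_smul]
  push_cast
  ring

theorem hasDerivAt_dilate {f : ℝ → ℂ} (hf : IsTest f) (N : ℕ) (t r : ℝ) :
    HasDerivAt (fun t => dilate N t f r) (dilate N t (symEuler N f) r) t := by
  have h1 : HasDerivAt (fun t => Real.exp t * r) (Real.exp t * r) t :=
    (Real.hasDerivAt_exp t).mul_const r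
  have h2 : HasDerivAt (fun t : ℝ => ((N : ℝ) - 2) / 2 * t) (((N : ℝ) - 2) / 2) t := by
    simpa using (hasDerivAt_id t).const_mul (((N : ℝ) - 2) / 2)
  refine (h2.exp.ofReal_comp.mul ((hf.hasDerivAt (Real.exp t * r)).scomp t h1)).congr_deriv ?_
  simp only [dilate, symEuler, Complex.real_smul, Function.comp_apply]
  push_cast
  ring

theorem Tformula_eq {f : ℝ → ℂ} (hf : IsTest f) (N m : ℕ) (c₁ c₂ c₃ : ℝ) (r : ℝ) :
    Tformula N m c₁ c₂ c₃ f r = 2 * c₁ * symEuler N f r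
      + Complex.I * (c₂ - c₃ * ((m : ℝ) + ((N : ℝ) - 2) / 2 : ℝ) ^ 2 : ℝ) * f r
      + Complex.I * c₃ * symEuler N (symEuler N f) r := by
  have h : HasDerivAt (symEuler N f) (deriv f r + r * deriv (deriv f) r +
      ((N : ℂ) - 2) / 2 * deriv f r) r := by
    have h1 : HasDerivAt (fun r : ℝ => (r : ℂ)) 1 r := Complex.ofRealCLM.hasDerivAt
    refine ((h1.mul (hf.deriv.hasDerivAt r)).add
      ((hf.hasDerivAt r).const_mul (((N : ℂ) - 2) / 2))).congr_deriv ?_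
    ring
  rw [show symEuler N (symEuler N f) r = r * deriv (symEuler N f) r +
    ((N : ℂ) - 2) / 2 * symEuler N f r from rfl, h.deriv, Tformula, symEuler]
  push_cast
  ring

/-! ### The radial measure -/

theorem radMeasure_lt_top {N : ℕ} {K : Set ℝ} (hK : IsCompact K) (hK0 : K ⊆ Set.Ioi 0) :
    radMeasure N K < ⊤ := by
  have hc : ContinuousOn (fun r : ℝ => r ^ ((N : ℝ) - 3)) K := fun r hr =>
    (Real.continuousAt_rpow_const r _ (Or.inl (ne_of_gt (hK0 hr)))).continuousWithinAt
  have hint : IntegrableOn (fun r : ℝ => r ^ ((N : ℝ) - 3)) K := hc.integrableOn_compact hK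
  rw [radMeasure, withDensity_apply _ hK.measurableSet,
    Measure.restrict_restrict hK.measurableSet, Set.inter_eq_left.2 hK0]
  exact hint.lintegral_lt_top

theorem integral_radMeasure {E : Type*} [NormedAddCommGroup E] [NormedSpace ℝ E] (N : ℕ)
    (g : ℝ → E) :
    ∫ r, g r ∂radMeasure N = ∫ r in Set.Ioi 0, r ^ ((N : ℝ) - 3) • g r := by
  rw [radMeasure, integral_withDensity_eq_integral_toReal_smul (by fun_prop) (by simp)]
  refine setIntegral_congr_fun measurableSet_Ioi fun r hr => ?_
  simp only [ENNReal.toReal_ofReal (Real.rpow_nonneg (le_of_lt hr) _)]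

theorem integrable_radMeasure_iff {E : Type*} [NormedAddCommGroup E] [NormedSpace ℝ E] {N : ℕ}
    {g : ℝ → E} :
    Integrable g (radMeasure N) ↔
      IntegrableOn (fun r => r ^ ((N : ℝ) - 3) • g r) (Set.Ioi 0) := by
  rw [radMeasure, integrable_withDensity_iff_integrable_smul' (by fun_prop) (by simp)]
  refine integrableOn_congr_fun (fun r hr => ?_) measurableSet_Ioi
  simp only [ENNReal.toReal_ofReal (Real.rpow_nonneg (le_of_lt hr) _)]

theorem ae_radMeasure_pos (N : ℕ) : ∀ᵐ r ∂radMeasure N, 0 < r :=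
  (withDensity_absolutelyContinuous _ _).ae_le (ae_restrict_mem measurableSet_Ioi)

theorem IsTest.memLp {f : ℝ → ℂ} (hf : IsTest f) (N : ℕ) (p : ENNReal) :
    MemLp f p (radMeasure N) := by
  obtain ⟨C, hC⟩ := hf.continuous.bounded_above_of_compact_support hf.hasCompactSupport
  have hfin : IsFiniteMeasure ((radMeasure N).restrict (tsupport f)) :=
    ⟨by simpa using radMeasure_lt_top hf.hasCompactSupport hf.tsupport_subset⟩
  have h : MemLp f p ((radMeasure N).restrict (tsupport f)) :=
    MemLp.of_bound hf.continuous.aestronglyMeasurable C (Filter.Eventually.of_forall hC)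
  rwa [← memLp_indicator_iff_restrict (isClosed_tsupport f).measurableSet,
    Set.indicator_eq_self.2 (subset_tsupport f)] at h

theorem IsTest.integrable {f : ℝ → ℂ} (hf : IsTest f) (N : ℕ) : Integrable f (radMeasure N) :=
  memLp_one_iff_integrable.1 (hf.memLp N 1)

theorem locallyIntegrableOn_of_memLp {N : ℕ} {v : ℝ → ℂ} (hv : MemLp v 2 (radMeasure N)) :
    LocallyIntegrableOn v (Set.Ioi 0) (radMeasure N) := by
  rw [locallyIntegrableOn_iff isOpen_Ioi.isLocallyClosed]
  intro K hK0 hK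
  have hfin : IsFiniteMeasure ((radMeasure N).restrict K) :=
    ⟨by simpa using radMeasure_lt_top hK hK0⟩
  exact (hv.restrict K).integrable one_le_two

/-- An `L²` function orthogonal to all test functions vanishes. -/
theorem ae_eq_zero_of_integral_mul_isTest {N : ℕ} {v : ℝ → ℂ} (hv : MemLp v 2 (radMeasure N))
    (h : ∀ f, IsTest f → ∫ r, v r * f r ∂radMeasure N = 0) : v =ᵐ[radMeasure N] 0 := by
  have h1 := isOpen_Ioi.ae_eq_zero_of_integral_contDiff_smul_eq_zero
    (locallyIntegrableOn_of_memLp hv) fun g hg hgc hgs => by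
      have ht : IsTest fun r => (g r : ℂ) :=
        ⟨Complex.ofRealCLM.contDiff.comp hg, hgc.comp_left (g := Complex.ofReal) (by simp),
          (closure_mono fun r hr => by simpa using hr).trans hgs⟩
      simpa [mul_comm] using h _ ht
  filter_upwards [h1, ae_radMeasure_pos N] with r hr hr0 using hr hr0

theorem integral_deriv_add_eq_zero {h : ℝ → ℂ} (hh : IsTest h) (N : ℕ) :
    ∫ r, ((r : ℂ) * deriv h r + ((N : ℂ) - 2) * h r) ∂radMeasure N = 0 := by
  have hint : Integrable (fun r : ℝ => (r : ℂ) * deriv h r + ((N : ℂ) - 2) * h r)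
      (radMeasure N) :=
    ((hh.deriv.mul_left Complex.ofRealCLM.contDiff).add (hh.const_mul _)).integrable N
  rw [integrable_radMeasure_iff] at hint
  rw [integral_radMeasure]
  have h0 : ∀ᶠ r : ℝ in nhds 0, h r = 0 := by
    have : (0 : ℝ) ∉ tsupport h := fun h0 => lt_irrefl (0 : ℝ) (hh.tsupport_subset h0)
    exact notMem_tsupport_iff_eventuallyEq.1 this
  have htop : ∀ᶠ r in Filter.atTop, h r = 0 := by
    have := hh.hasCompactSupport
    rw [hasCompactSupport_iff_eventuallyEq, Filter.coclosedCompact_eq_cocompact] at this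
    exact this.filter_mono atTop_le_cocompact
  rw [integral_Ioi_of_hasDerivAt_of_tendsto (f := fun r : ℝ => r ^ ((N : ℝ) - 2) • h r) (m := 0)
    _ _ hint _]
  · simp [h0.self_of_nhds]
  · refine ContinuousAt.continuousWithinAt ?_
    exact (continuousAt_const (y := (0 : ℂ))).congr
      (h0.mono fun r hr => by simp [hr])
  · intro r hr
    have hr' : (0 : ℝ) < r := hr
    have hd := (Real.hasDerivAt_rpow_const (x := r) (p := (N : ℝ) - 2) (Or.inl hr'.ne')).smul
      (hh.hasDerivAt r)
    refine hd.congr_deriv ?_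
    have e1 : (N : ℝ) - 2 - 1 = (N : ℝ) - 3 := by ring
    have e2 : r ^ ((N : ℝ) - 2) = r ^ ((N : ℝ) - 3) * r := by
      rw [← Real.rpow_add_one hr'.ne']; ring_nf
    simp only [e1, e2, Complex.real_smul]
    push_cast
    ring
  · exact tendsto_const_nhds.congr' (htop.mono fun r hr => by simp [hr])

theorem integral_conj_mul_symEuler {f g : ℝ → ℂ} (hf : IsTest f) (hg : IsTest g) (N : ℕ) :
    ∫ r, starRingEnd ℂ (f r) * symEuler N g r ∂radMeasure N =
      -∫ r, starRingEnd ℂ (symEuler N f r) * g r ∂radMeasure N := by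
  have hconj : ∀ {u : ℝ → ℂ}, IsTest u → ContDiff ℝ (⊤ : ℕ∞) fun r => starRingEnd ℂ (u r) :=
    fun hu => Complex.conjCLE.contDiff.comp hu.contDiff
  have h1 := integral_deriv_add_eq_zero (hg.mul_left (hconj hf)) N
  have hi1 := ((hg.symEuler N).mul_left (hconj hf)).integrable N
  have hi2 := (hg.mul_left (hconj (hf.symEuler N))).integrable N
  rw [eq_neg_iff_add_eq_zero, ← integral_add hi1 hi2, ← h1]
  refine integral_congr_ae (Filter.Eventually.of_forall fun r => ?_)
  have hd : HasDerivAt (fun r => starRingEnd ℂ (f r)) (starRingEnd ℂ (deriv f r)) r :=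
    (hf.hasDerivAt r).star
  have hd' : deriv (fun r => starRingEnd ℂ (f r) * g r) r =
      starRingEnd ℂ (deriv f r) * g r + starRingEnd ℂ (f r) * deriv g r :=
    (hd.mul (hg.hasDerivAt r)).deriv
  simp only [hd', symEuler, map_add, map_mul, map_sub, map_div₀, Complex.conj_ofReal,
    Complex.conj_natCast, Complex.conj_ofNat]
  ring

/-! ### Pairing with dilated test functions -/

theorem integral_norm_sq_dilate (N : ℕ) (t : ℝ) (f : ℝ → ℂ) :
    ∫ r, ‖dilate N t f r‖ ^ 2 ∂radMeasure N = ∫ r, ‖f r‖ ^ 2 ∂radMeasure N := by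
  have hcomp := integral_comp_mul_left_Ioi (fun x : ℝ => x ^ ((N : ℝ) - 3) • ‖f x‖ ^ 2) 0
    (Real.exp_pos t)
  rw [mul_zero, eq_inv_smul_iff₀ (Real.exp_pos t).ne'] at hcomp
  rw [integral_radMeasure, integral_radMeasure, ← hcomp, ← integral_smul]
  refine setIntegral_congr_fun measurableSet_Ioi fun r hr => ?_
  have hr' : (0 : ℝ) < r := hr
  have hexp : Real.exp (((N : ℝ) - 2) / 2 * t) ^ 2 = Real.exp t * Real.exp t ^ ((N : ℝ) - 3) := by
    rw [← Real.exp_nat_mul, ← Real.exp_mul, ← Real.exp_add]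
    congr 1
    push_cast
    ring
  simp only [dilate, norm_mul, mul_pow, Complex.norm_real, Real.norm_eq_abs, Real.abs_exp, hexp,
    smul_eq_mul, Real.mul_rpow (Real.exp_pos t).le hr'.le]
  ring

theorem inner_eq_integral {N : ℕ} {u v : Lp ℂ 2 (radMeasure N)} {f g : ℝ → ℂ}
    (hf : (u : ℝ → ℂ) =ᵐ[radMeasure N] f) (hg : (v : ℝ → ℂ) =ᵐ[radMeasure N] g) :
    inner ℂ u v = ∫ r, starRingEnd ℂ (f r) * g r ∂radMeasure N := by
  rw [L2.inner_def]
  refine integral_congr_ae ?_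
  filter_upwards [hf, hg] with r h1 h2
  rw [RCLike.inner_apply, h1, h2, mul_comm]

theorem exists_bound_integral_dilate {N : ℕ} (v : Lp ℂ 2 (radMeasure N)) {f : ℝ → ℂ}
    (hf : IsTest f) :
    ∃ C, ∀ t, ‖∫ r, starRingEnd ℂ (v r) * dilate N t f r ∂radMeasure N‖ ≤ C := by
  refine ⟨‖v‖ * √(∫ r, ‖f r‖ ^ 2 ∂radMeasure N), fun t => ?_⟩
  have hg := hf.dilate N t
  have hL := (hg.memLp N 2).coeFn_toLp
  rw [← inner_eq_integral Filter.EventuallyEq.rfl hL]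
  refine (norm_inner_le_norm _ _).trans (mul_le_mul_of_nonneg_left ?_ (norm_nonneg _))
  refine Real.le_sqrt_of_sq_le (le_of_eq ?_)
  have h1 := inner_eq_integral hL hL
  rw [inner_self_eq_norm_sq_to_K] at h1
  have h2 : ∀ r, starRingEnd ℂ (dilate N t f r) * dilate N t f r =
      ((‖dilate N t f r‖ ^ 2 : ℝ) : ℂ) := fun r => by
    rw [mul_comm, Complex.mul_conj, Complex.normSq_eq_norm_sq]
  simp only [h2] at h1
  rw [integral_complex_ofReal, integral_norm_sq_dilate] at h1
  exact Complex.ofReal_injective ((Complex.ofReal_pow _ _).trans h1)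

theorem integral_linear_combination {α : Type*} [MeasurableSpace α] {μ : Measure α}
    {p q s : α → ℂ} (hp : Integrable p μ) (hq : Integrable q μ) (hs : Integrable s μ) (a b c : ℂ) :
    ∫ x, (a * p x + b * q x + c * s x) ∂μ =
      a * ∫ x, p x ∂μ + b * ∫ x, q x ∂μ + c * ∫ x, s x ∂μ := by
  have hpq : Integrable (fun x => a * p x + b * q x) μ := (hp.const_mul a).add (hq.const_mul b)
  rw [integral_add hpq (hs.const_mul c), integral_add (hp.const_mul a) (hq.const_mul b),
    integral_const_mul, integral_const_mul, integral_const_mul]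

theorem IsTest.integrable_mul {N : ℕ} {f w : ℝ → ℂ} (hf : IsTest f)
    (hw : MemLp w 2 (radMeasure N)) : Integrable (fun r => w r * f r) (radMeasure N) :=
  hw.integrable_mul (hf.memLp N 2)

theorem hasDerivAt_integral_dilate {N : ℕ} {w f : ℝ → ℂ} (hw : MemLp w 2 (radMeasure N))
    (hf : IsTest f) (t₀ : ℝ) :
    HasDerivAt (fun t => ∫ r, w r * dilate N t f r ∂radMeasure N)
      (∫ r, w r * dilate N t₀ (symEuler N f) r ∂radMeasure N) t₀ := by
  have hg := hf.symEuler N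
  obtain ⟨a, b, ha, hab⟩ := hg.exists_support_subset_Icc
  obtain ⟨M, hM⟩ := hg.continuous.bounded_above_of_compact_support hg.hasCompactSupport
  have hM0 : 0 ≤ M := (norm_nonneg _).trans (hM 0)
  obtain ⟨P, hP⟩ := (isCompact_Icc (a := t₀ - 1) (b := t₀ + 1)).exists_bound_of_continuousOn
    (f := fun t => Real.exp (((N : ℝ) - 2) / 2 * t)) (by fun_prop)
  have hP0 : 0 ≤ P := (norm_nonneg _).trans (hP t₀ ⟨by linarith, by linarith⟩)
  let K : Set ℝ := Set.Icc (a * Real.exp (-(t₀ + 1))) (b * Real.exp (-(t₀ - 1)))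
  have hK0 : K ⊆ Set.Ioi 0 := fun r hr => lt_of_lt_of_le (mul_pos ha (Real.exp_pos _)) hr.1
  have hbd : ∀ r, ∀ t ∈ Set.Icc (t₀ - 1) (t₀ + 1),
      ‖w r * dilate N t (symEuler N f) r‖ ≤ ‖w r * K.indicator (fun _ => ((P * M : ℝ) : ℂ)) r‖ := by
    intro r t ht
    rw [norm_mul, norm_mul]
    refine mul_le_mul_of_nonneg_left ?_ (norm_nonneg _)
    by_cases h0 : symEuler N f (Real.exp t * r) = 0
    · simp [dilate, h0]
    · have hmem := hab _ h0
      have hr : r = Real.exp t * r * Real.exp (-t) := by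
        rw [Real.exp_neg]
        field_simp
      have hb : 0 ≤ b := ha.le.trans (hmem.1.trans hmem.2)
      have hrK : r ∈ K := by
        constructor
        · rw [hr]
          exact mul_le_mul hmem.1 (Real.exp_le_exp.2 (by linarith [ht.2])) (Real.exp_pos _).le
            (ha.le.trans hmem.1)
        · rw [hr]
          exact mul_le_mul hmem.2 (Real.exp_le_exp.2 (by linarith [ht.1])) (Real.exp_pos _).le hb
      rw [Set.indicator_of_mem hrK, Complex.norm_real, Real.norm_of_nonneg (mul_nonneg hP0 hM0),
        dilate, norm_mul, Complex.norm_real]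
      exact mul_le_mul (hP t ht) (hM _) (norm_nonneg _) hP0
  have hind : MemLp (K.indicator fun _ => ((P * M : ℝ) : ℂ)) 2 (radMeasure N) :=
    memLp_indicator_const 2 measurableSet_Icc _ (Or.inr (radMeasure_lt_top isCompact_Icc hK0).ne)
  have hbound : Integrable (fun r => ‖w r * K.indicator (fun _ => ((P * M : ℝ) : ℂ)) r‖)
      (radMeasure N) := (hw.integrable_mul hind).norm
  have hmeas : ∀ t, AEStronglyMeasurable (fun r => w r * dilate N t f r) (radMeasure N) :=
    fun t => ((hf.dilate N t).integrable_mul hw).aestronglyMeasurable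
  have hmeas' := ((hg.dilate N t₀).integrable_mul hw).aestronglyMeasurable
  have hderiv : ∀ r, ∀ t ∈ Set.Icc (t₀ - 1) (t₀ + 1), HasDerivAt
      (fun t => w r * dilate N t f r) (w r * dilate N t (symEuler N f) r) t :=
    fun r t _ => (hasDerivAt_dilate hf N t r).const_mul (w r)
  exact (hasDerivAt_integral_of_dominated_loc_of_deriv_le
    (F := fun t r => w r * dilate N t f r) (F' := fun t r => w r * dilate N t (symEuler N f) r)
    (Icc_mem_nhds (by linarith : t₀ - 1 < t₀) (by linarith : t₀ < t₀ + 1))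
    (Filter.Eventually.of_forall hmeas) ((hf.dilate N t₀).integrable_mul hw) hmeas'
    (Filter.Eventually.of_forall hbd) hbound (Filter.Eventually.of_forall hderiv)).2

theorem memLp_conj {N : ℕ} (v : Lp ℂ 2 (radMeasure N)) :
    MemLp (fun r => starRingEnd ℂ (v r)) 2 (radMeasure N) :=
  (Lp.memLp v).star

theorem Lp_eq_zero_of_forall_isTest {N : ℕ} (v : Lp ℂ 2 (radMeasure N))
    (h : ∀ f, IsTest f → ∫ r, starRingEnd ℂ (v r) * f r ∂radMeasure N = 0) : v = 0 := by
  rw [Lp.eq_zero_iff_ae_eq_zero]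
  filter_upwards [ae_eq_zero_of_integral_mul_isTest (memLp_conj v) h] with r hr
  simpa using hr

theorem Lp_eq_zero_of_orthogonal {N : ℕ} (m : ℕ) (c₁ c₂ c₃ : ℝ) {σ : ℝ} (hσ : σ ≠ 0)
    (v : Lp ℂ 2 (radMeasure N))
    (h : ∀ f, IsTest f →
      ∫ r, starRingEnd ℂ (v r) * (Tformula N m c₁ c₂ c₃ f r + σ * f r) ∂radMeasure N = 0) :
    v = 0 := by
  refine Lp_eq_zero_of_forall_isTest v fun f hf => ?_
  have hv := memLp_conj v
  obtain ⟨C, hC⟩ := exists_bound_integral_dilate v hf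
  obtain ⟨C', hC'⟩ := exists_bound_integral_dilate v (hf.symEuler N)
  have key := eq_zero_of_bounded_of_hasDerivAt (a := c₁) (c := c₃)
    (b := c₂ - c₃ * ((m : ℝ) + ((N : ℝ) - 2) / 2) ^ 2) hσ
    (hasDerivAt_integral_dilate hv hf) (hasDerivAt_integral_dilate hv (hf.symEuler N)) hC hC'
    (fun t => ?_) 0
  · simpa [dilate] using key
  · have h0 := h _ (hf.dilate N t)
    have i0 := (hf.dilate N t).integrable_mul hv
    have i1 := ((hf.symEuler N).dilate N t).integrable_mul hv
    have i2 := (((hf.symEuler N).symEuler N).dilate N t).integrable_mul hv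
    rw [← h0, ← integral_linear_combination i2 i1 i0]
    refine integral_congr_ae (Filter.Eventually.of_forall fun r => ?_)
    simp only [Tformula_eq (hf.dilate N t), symEuler_dilate hf,
      symEuler_dilate (hf.symEuler N)]
    ring

theorem integral_conj_mul_Tformula {f g : ℝ → ℂ} (hf : IsTest f) (hg : IsTest g) (N m : ℕ)
    (c₁ c₂ c₃ : ℝ) :
    ∫ r, starRingEnd ℂ (Tformula N m c₁ c₂ c₃ f r) * g r ∂radMeasure N =
      -∫ r, starRingEnd ℂ (f r) * Tformula N m c₁ c₂ c₃ g r ∂radMeasure N := by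
  have hi : ∀ {u w : ℝ → ℂ}, IsTest u → IsTest w →
      Integrable (fun r => starRingEnd ℂ (u r) * w r) (radMeasure N) :=
    fun hu hw => hw.integrable_mul (hu.memLp N 2).star
  have hf1 := hf.symEuler N
  have hg1 := hg.symEuler N
  have hf2 := hf1.symEuler N
  have hg2 := hg1.symEuler N
  have e1 := integral_conj_mul_symEuler hf hg N
  have e2 := integral_conj_mul_symEuler hf hg1 N
  have e3 := integral_conj_mul_symEuler hf1 hg N
  set b : ℝ := c₂ - c₃ * ((m : ℝ) + ((N : ℝ) - 2) / 2) ^ 2 with hb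
  have hL : ∫ r, starRingEnd ℂ (Tformula N m c₁ c₂ c₃ f r) * g r ∂radMeasure N =
      2 * c₁ * ∫ r, starRingEnd ℂ (symEuler N f r) * g r ∂radMeasure N
      + (-(Complex.I * b)) * ∫ r, starRingEnd ℂ (f r) * g r ∂radMeasure N
      + (-(Complex.I * c₃)) *
        ∫ r, starRingEnd ℂ (symEuler N (symEuler N f) r) * g r ∂radMeasure N := by
    rw [← integral_linear_combination (hi hf1 hg) (hi hf hg) (hi hf2 hg)]
    refine integral_congr_ae (Filter.Eventually.of_forall fun r => ?_)
    simp only [Tformula_eq hf, ← hb, map_add, map_mul, Complex.conj_ofReal, Complex.conj_I,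
      Complex.conj_ofNat]
    ring
  have hR : ∫ r, starRingEnd ℂ (f r) * Tformula N m c₁ c₂ c₃ g r ∂radMeasure N =
      2 * c₁ * ∫ r, starRingEnd ℂ (f r) * symEuler N g r ∂radMeasure N
      + (Complex.I * b) * ∫ r, starRingEnd ℂ (f r) * g r ∂radMeasure N
      + (Complex.I * c₃) *
        ∫ r, starRingEnd ℂ (f r) * symEuler N (symEuler N g) r ∂radMeasure N := by
    rw [← integral_linear_combination (hi hf hg1) (hi hf hg) (hi hf hg2)]
    refine integral_congr_ae (Filter.Eventually.of_forall fun r => ?_)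
    simp only [Tformula_eq hg, ← hb]
    ring
  rw [hL, hR]
  linear_combination 2 * c₁ * e1 + Complex.I * c₃ * e2 - Complex.I * c₃ * e3

theorem stmt7 (N : ℕ) (hN : 1 ≤ N) (m : ℕ) (c₁ c₂ c₃ : ℝ)
    (T : Lp ℂ 2 (radMeasure N) →ₗ.[ℂ] Lp ℂ 2 (radMeasure N))
    -- the domain of `T` consists of the classes of smooth compactly supported
    -- functions on `(0, ∞)`
    (hdom : ∀ F : Lp ℂ 2 (radMeasure N), F ∈ T.domain ↔
      ∃ f : ℝ → ℂ, ContDiff ℝ (⊤ : ℕ∞) f ∧ HasCompactSupport f ∧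
        tsupport f ⊆ Set.Ioi 0 ∧ (F : ℝ → ℂ) =ᵐ[radMeasure N] f)
    -- `T` acts by the differential operator
    -- `c₁ (2ϑ + N - 2) + i c₂ + i c₃ (ϑ - m)(ϑ + m + N - 2)`
    (hT : ∀ (F : T.domain) (f : ℝ → ℂ), ContDiff ℝ (⊤ : ℕ∞) f → HasCompactSupport f →
      tsupport f ⊆ Set.Ioi 0 → ((F : Lp ℂ 2 (radMeasure N)) : ℝ → ℂ) =ᵐ[radMeasure N] f →
      ((T F : Lp ℂ 2 (radMeasure N)) : ℝ → ℂ) =ᵐ[radMeasure N] Tformula N m c₁ c₂ c₃ f) :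
    T.IsClosable ∧ T.adjoint = -T.closure := by
  have hrep : ∀ x : T.domain, ∃ f, IsTest f ∧
      ((x : Lp ℂ 2 (radMeasure N)) : ℝ → ℂ) =ᵐ[radMeasure N] f ∧
      ((T x : Lp ℂ 2 (radMeasure N)) : ℝ → ℂ) =ᵐ[radMeasure N] Tformula N m c₁ c₂ c₃ f := by
    intro x
    obtain ⟨f, h1, h2, h3, h4⟩ := (hdom x).1 x.2
    exact ⟨f, ⟨h1, h2, h3⟩, h4, hT x f h1 h2 h3 h4⟩
  have hlift : ∀ f, IsTest f → ∃ x : T.domain,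
      ((x : Lp ℂ 2 (radMeasure N)) : ℝ → ℂ) =ᵐ[radMeasure N] f ∧
      ((T x : Lp ℂ 2 (radMeasure N)) : ℝ → ℂ) =ᵐ[radMeasure N] Tformula N m c₁ c₂ c₃ f := by
    intro f hf
    have hL := (hf.memLp N 2).coeFn_toLp
    have hmem : (hf.memLp N 2).toLp f ∈ T.domain :=
      (hdom _).2 ⟨f, hf.contDiff, hf.hasCompactSupport, hf.tsupport_subset, hL⟩
    exact ⟨⟨_, hmem⟩, hL, hT ⟨_, hmem⟩ f hf.contDiff hf.hasCompactSupport hf.tsupport_subset hL⟩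
  refine adjoint_eq_neg_closure_of_dense_range T ?_ ?_ ?_ ?_
  · rw [Submodule.dense_iff_topologicalClosure_eq_top, Submodule.topologicalClosure_eq_top_iff,
      Submodule.eq_bot_iff]
    intro v hv
    refine Lp_eq_zero_of_forall_isTest v fun f hf => ?_
    obtain ⟨x, hx, -⟩ := hlift f hf
    rw [← inner_eq_integral Filter.EventuallyEq.rfl hx]
    exact (Submodule.mem_orthogonal' _ _).1 hv _ x.2
  · intro x y
    obtain ⟨f, hf, hxf, hTf⟩ := hrep x
    obtain ⟨g, hg, hyg, hTg⟩ := hrep y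
    rw [inner_eq_integral hTf hyg, inner_eq_integral hxf hTg]
    exact integral_conj_mul_Tformula hf hg N m c₁ c₂ c₃
  · intro v hv
    refine Lp_eq_zero_of_orthogonal m c₁ c₂ c₃ one_ne_zero v fun f hf => ?_
    obtain ⟨x, hx, hTx⟩ := hlift f hf
    rw [← hv x]
    refine (inner_eq_integral Filter.EventuallyEq.rfl ?_).symm
    filter_upwards [Lp.coeFn_add (T x) (x : Lp ℂ 2 (radMeasure N)), hx, hTx] with r h1 h2 h3
    rw [h1, Pi.add_apply, h2, h3, Complex.ofReal_one, one_mul]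
  · intro v hv
    refine Lp_eq_zero_of_orthogonal m c₁ c₂ c₃ (neg_ne_zero.2 one_ne_zero) v fun f hf => ?_
    obtain ⟨x, hx, hTx⟩ := hlift f hf
    rw [← hv x]
    refine (inner_eq_integral Filter.EventuallyEq.rfl ?_).symm
    filter_upwards [Lp.coeFn_sub (T x) (x : Lp ℂ 2 (radMeasure N)), hx, hTx] with r h1 h2 h3
    rw [h1, Pi.sub_apply, h2, h3, Complex.ofReal_neg, Complex.ofReal_one, neg_one_mul,
      sub_eq_add_neg]
end

section
/- Let z ∈ ℂ with Re z > 0 and let θ ∈ ℝ. Then ∑_{m=0}^∞ (m+1)·exp(−z·(m+1)²)·sin((m+1)θ) = −(1/(4π))·jacobiTheta₂′( θ/(2π), i·z/π ), where the series on the left converges absolutely. (This is the key series evaluation in the closed-form expression of the integral kernel of exp(z‖x‖²Δ) in dimension N = 4.) -/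
open Real Complex

theorem jacobiTheta₂'_term_add_neg (z : ℂ) (θ : ℝ) (n : ℤ) :
    jacobiTheta₂'_term n ((θ : ℂ) / (2 * (π : ℂ))) (Complex.I * z / (π : ℂ)) +
      jacobiTheta₂'_term (-n) ((θ : ℂ) / (2 * (π : ℂ))) (Complex.I * z / (π : ℂ)) =
    -(4 * (π : ℂ)) * ((n : ℂ) * Complex.exp (-z * (n : ℂ) ^ 2) * Complex.sin ((n : ℂ) * θ)) := by
  have hπ : (π : ℂ) ≠ 0 := ofReal_ne_zero.mpr Real.pi_ne_zero
  have exp_term (k : ℂ) : Complex.exp (2 * π * I * k * (θ / (2 * π)) + π * I * k ^ 2 * (I * z / π)) =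
      Complex.exp (-z * k ^ 2) * Complex.exp (k * θ * I) := by
    rw [← Complex.exp_add]
    congr 1
    field_simp
    linear_combination k * z * k * Complex.I_sq
  simp only [jacobiTheta₂'_term, jacobiTheta₂_term, Int.cast_neg, exp_term, Complex.sin]
  ring_nf

theorem hasSum_mul_exp_mul_sin (z : ℂ) (hz : 0 < z.re) (θ : ℝ) :
    HasSum (fun m : ℕ => ((m : ℂ) + 1) * Complex.exp (-z * ((m : ℂ) + 1) ^ 2) *
        (Real.sin (((m : ℝ) + 1) * θ) : ℂ))
      (-(1 / (4 * (π : ℂ))) *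
        jacobiTheta₂' ((θ : ℂ) / (2 * (π : ℂ))) (Complex.I * z / (π : ℂ))) := by
  have hτ : 0 < (Complex.I * z / (π : ℂ)).im := by
    rw [Complex.div_ofReal_im, Complex.I_mul_im]
    exact div_pos hz Real.pi_pos
  have hπ : (π : ℂ) ≠ 0 := ofReal_ne_zero.mpr Real.pi_ne_zero
  have h := (hasSum_jacobiTheta₂'_term ((θ : ℂ) / (2 * (π : ℂ))) hτ).nat_add_neg
  rw [← hasSum_nat_add_iff' 1] at h
  convert h.mul_left (-(1 / (4 * (π : ℂ)))) using 1
  · rfl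
  · funext m
    rw [jacobiTheta₂'_term_add_neg]
    push_cast
    field_simp
  · simp [jacobiTheta₂'_term]

theorem stmt11 (z : ℂ) (hz : 0 < z.re) (θ : ℝ) :
    Summable (fun m : ℕ =>
      ‖((m : ℂ) + 1) * Complex.exp (-z * ((m : ℂ) + 1) ^ 2) *
        (Real.sin (((m : ℝ) + 1) * θ) : ℂ)‖) ∧
    ∑' m : ℕ, ((m : ℂ) + 1) * Complex.exp (-z * ((m : ℂ) + 1) ^ 2) *
        (Real.sin (((m : ℝ) + 1) * θ) : ℂ) =
      -(1 / (4 * (π : ℂ))) *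
        jacobiTheta₂' ((θ : ℂ) / (2 * (π : ℂ))) (Complex.I * z / (π : ℂ)) := by
  have h := hasSum_mul_exp_mul_sin z hz θ
  exact ⟨h.summable.norm, h.tsum_eq⟩
end
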